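/- arXiv:2402.16623 — 9 statements merged into one kernel-verified Lean document; each statement's English description precedes it below -/
import Mathlib

section
/- If r ≥ 1 and η = rβ − 3/2 > 0, then the Gibbs energy functional G(x, θ) = (1/(2σ²))‖Fx − y‖₂² + (1/2)∑_{i=1}^N x_i²/θ_i + ∑_{i=1}^N (θ_i/ϑ_i)^r − η ∑_{i=1}^N log θ_i is strictly convex on ℝ^N × ℝ_{++}^N. -/
open Real Filter

/-- The Gibbs energy functional
`G(x, θ) = (1/(2σ²))‖Fx − y‖₂² + (1/2)∑ᵢ xᵢ²/θᵢ + ∑ᵢ (θᵢ/ϑᵢ)^r − η ∑ᵢ log θᵢ`. -/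
noncomputable def gibbsG (N M : ℕ) (F : Matrix (Fin M) (Fin N) ℝ) (y : Fin M → ℝ)
    (σ r η : ℝ) (vth : Fin N → ℝ) : (Fin N → ℝ) × (Fin N → ℝ) → ℝ :=
  fun p =>
    (1 / (2 * σ ^ 2)) * ∑ j, (F.mulVec p.1 j - y j) ^ 2
      + (1 / 2) * ∑ i, (p.1 i) ^ 2 / p.2 i
      + ∑ i, (p.2 i / vth i) ^ r
      - η * ∑ i, Real.log (p.2 i)

/-- The Jensen gap of the perspective function `x ^ 2 / t`. -/
lemma sq_div_jensen_gap {x x' t t' a b : ℝ} (ht : 0 < t) (ht' : 0 < t')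
    (ha : 0 < a) (hb : 0 < b) (hab : a + b = 1) :
    a * (x ^ 2 / t) + b * (x' ^ 2 / t') - (a * x + b * x') ^ 2 / (a * t + b * t')
      = a * b * (x * t' - x' * t) ^ 2 / (t * t' * (a * t + b * t')) := by
  have h : a * t + b * t' ≠ 0 := by positivity
  obtain rfl : b = 1 - a := by linarith
  field_simp
  ring

/-- The part of the Gibbs energy depending on a single coordinate pair `(xᵢ, θᵢ)`, data term
excluded, is strictly convex. -/
lemma strictConvexOn_sq_div_add_rpow_sub_log {r η v : ℝ} (hr : 1 ≤ r) (hη : 0 < η) (hv : 0 < v) :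
    StrictConvexOn ℝ {p : ℝ × ℝ | 0 < p.2}
      (fun p => 1 / 2 * (p.1 ^ 2 / p.2) + (p.2 / v) ^ r - η * Real.log p.2) := by
  refine ⟨convex_halfSpace_gt (LinearMap.snd ℝ ℝ ℝ).isLinear 0, ?_⟩
  rintro ⟨x, t⟩ (ht : 0 < t) ⟨x', t'⟩ (ht' : 0 < t') hne a b ha hb hab
  simp only [Prod.smul_mk, Prod.mk_add_mk, smul_eq_mul]
  have hs : 0 < a * t + b * t' := by positivity
  have hgap := sq_div_jensen_gap (x := x) (x' := x') ht ht' ha hb hab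
  have hpow : ((a * t + b * t') / v) ^ r ≤ a * (t / v) ^ r + b * (t' / v) ^ r := by
    have h := (convexOn_rpow hr).2 (Set.mem_Ici.2 (div_pos ht hv).le)
      (Set.mem_Ici.2 (div_pos ht' hv).le) ha.le hb.le hab
    simp only [smul_eq_mul] at h
    rwa [show a * (t / v) + b * (t' / v) = (a * t + b * t') / v by ring] at h
  by_cases htt : t = t'
  · subst htt
    have hx : x - x' ≠ 0 := fun h => hne (by rw [sub_eq_zero.1 h])
    have hpos : 0 < a * b * (x * t - x' * t) ^ 2 / (t * t * (a * t + b * t)) := by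
      rw [← sub_mul]
      positivity
    have hlog : Real.log (a * t + b * t) = a * Real.log t + b * Real.log t := by
      rw [← add_mul, ← add_mul, hab, one_mul, one_mul]
    rw [hlog]
    linarith
  · have hnonneg : 0 ≤ a * b * (x * t' - x' * t) ^ 2 / (t * t' * (a * t + b * t')) := by
      positivity
    have hlog := strictConcaveOn_log_Ioi.2 (Set.mem_Ioi.2 ht) (Set.mem_Ioi.2 ht') htt ha hb hab
    simp only [smul_eq_mul] at hlog
    have := mul_lt_mul_of_pos_left hlog hη
    linarith

/-- A separable sum of strictly convex functions of the coordinate pairs is strictly convex. -/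
lemma StrictConvexOn.sum_coord_pairs {ι : Type*} [Fintype ι] {s : ι → Set (ℝ × ℝ)}
    {g : ι → ℝ × ℝ → ℝ} (hg : ∀ i, StrictConvexOn ℝ (s i) (g i)) :
    StrictConvexOn ℝ {p : (ι → ℝ) × (ι → ℝ) | ∀ i, (p.1 i, p.2 i) ∈ s i}
      (fun p => ∑ i, g i (p.1 i, p.2 i)) := by
  refine ⟨fun p hp q hq a b ha hb hab i => (hg i).1 (hp i) (hq i) ha hb hab, ?_⟩
  intro p hp q hq hne a b ha hb hab
  obtain ⟨i, hi⟩ : ∃ i, (p.1 i, p.2 i) ≠ (q.1 i, q.2 i) := by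
    by_contra! h
    exact hne (Prod.ext (funext fun i => congrArg Prod.fst (h i))
      (funext fun i => congrArg Prod.snd (h i)))
  simp only [Finset.smul_sum, ← Finset.sum_add_distrib]
  exact Finset.sum_lt_sum
    (fun j _ => (hg j).convexOn.2 (hp j) (hq j) ha.le hb.le hab)
    ⟨i, Finset.mem_univ i, (hg i).2 (hp i) (hq i) hi ha hb hab⟩

/-- The least-squares data term is convex. -/
lemma convexOn_sum_sq_mulVec_sub {m n : Type*} [Fintype m] [Fintype n]
    (F : Matrix m n ℝ) (y : m → ℝ) :
    ConvexOn ℝ Set.univ (fun x : n → ℝ => ∑ j, (F.mulVec x j - y j) ^ 2) := by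
  refine ⟨convex_univ, fun x _ x' _ a b ha hb hab => ?_⟩
  simp only [Finset.smul_sum, ← Finset.sum_add_distrib]
  refine Finset.sum_le_sum fun j _ => ?_
  have h := (even_two.convexOn_pow (𝕜 := ℝ)).2 (Set.mem_univ (F.mulVec x j - y j))
    (Set.mem_univ (F.mulVec x' j - y j)) ha hb hab
  convert h using 2
  simp only [Matrix.mulVec_add, Matrix.mulVec_smul, Pi.add_apply, Pi.smul_apply, smul_eq_mul]
  linear_combination y j * hab

/-- If `r ≥ 1` and `η = rβ − 3/2 > 0`, then the Gibbs energy functional is strictly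
convex on `ℝ^N × ℝ_{++}^N`. -/
theorem statement0 (N M : ℕ) (hN : 0 < N) (hM : 0 < M)
    (F : Matrix (Fin M) (Fin N) ℝ) (y : Fin M → ℝ)
    (σ : ℝ) (hσ : 0 < σ)
    (r β η : ℝ) (hr0 : r ≠ 0) (hβ : 0 < β) (hη_def : η = r * β - 3 / 2)
    (vth : Fin N → ℝ) (hvth : ∀ i, 0 < vth i)
    (hr : 1 ≤ r) (hη : 0 < η) :
    StrictConvexOn ℝ {p : (Fin N → ℝ) × (Fin N → ℝ) | ∀ i, 0 < p.2 i}
      (gibbsG N M F y σ r η vth) := by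
  have hsep := StrictConvexOn.sum_coord_pairs
    fun i => strictConvexOn_sq_div_add_rpow_sub_log hr hη (hvth i)
  have hdata := (((convexOn_sum_sq_mulVec_sub F y).smul
    (show 0 ≤ 1 / (2 * σ ^ 2) by positivity)).comp_linearMap
      (LinearMap.fst ℝ (Fin N → ℝ) (Fin N → ℝ))).subset (Set.subset_univ _) hsep.1
  refine (hdata.add_strictConvexOn hsep).congr fun p _ => ?_
  simp only [gibbsG, Pi.add_apply, Function.comp_apply, LinearMap.fst_apply, smul_eq_mul,
    Finset.sum_sub_distrib, Finset.sum_add_distrib, Finset.mul_sum]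
  ring
end

section
/- Suppose either (0 < r < 1 and η > 0) or (r < 0), where η = rβ − 3/2. Then the Gibbs energy functional G(x, θ) = (1/(2σ²))‖Fx − y‖₂² + (1/2)∑_{i=1}^N x_i²/θ_i + ∑_{i=1}^N (θ_i/ϑ_i)^r − η ∑_{i=1}^N log θ_i is convex on the convex open region consisting of all (x, θ) ∈ ℝ^N × ℝ_{++}^N with θ_i < ϑ_i (η/(r·|r − 1|))^{1/r} for every i = 1, …, N. -/
open Real Filter

/-- The perspective `x² / t` of the square is jointly convex on `t > 0`. -/
theorem convexOn_sq_div : ConvexOn ℝ {p : ℝ × ℝ | 0 < p.2} fun p => p.1 ^ 2 / p.2 := by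
  have hconv : Convex ℝ {p : ℝ × ℝ | 0 < p.2} :=
    (convex_Ioi (0 : ℝ)).linear_preimage (LinearMap.snd ℝ ℝ ℝ)
  refine ⟨hconv, ?_⟩
  rintro ⟨x, s⟩ hs ⟨y, t⟩ ht a b ha hb hab
  have hpos : 0 < a * s + b * t := hconv hs ht ha hb hab
  simp only [Set.mem_ofPred_eq] at hs ht
  simp only [Prod.smul_mk, Prod.mk_add_mk, smul_eq_mul]
  rw [div_le_iff₀ hpos]
  have hkey : (a * (x ^ 2 / s) + b * (y ^ 2 / t)) * (a * s + b * t) - (a * x + b * y) ^ 2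
      = a * b * (x * t - y * s) ^ 2 / (s * t) := by
    field_simp
    ring
  have hnonneg : 0 ≤ a * b * (x * t - y * s) ^ 2 / (s * t) := by positivity
  linarith

/-- On `0 < t < v (η / (r |r - 1|))^(1/r)` the second derivative of `(t / v) ^ r - η log t`,
multiplied by `t²`, is nonnegative. -/
theorem rpow_curvature_nonneg {r η v t : ℝ} (hv : 0 < v) (ht : 0 < t)
    (hcase : (0 < r ∧ r < 1 ∧ 0 < η) ∨ (r < 0 ∧ η < 0))
    (htv : t < v * (η / (r * |r - 1|)) ^ (1 / r)) :
    0 ≤ r * (r - 1) * (t / v) ^ r + η := by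
  have hlt : t / v < (η / (r * |r - 1|)) ^ (1 / r) := by
    rw [div_lt_iff₀ hv]
    linarith
  have htv0 : 0 < t / v := div_pos ht hv
  rcases hcase with ⟨hr, hr1, hη⟩ | ⟨hr, hη⟩
  · have habs : |r - 1| = 1 - r := by rw [abs_of_neg (by linarith)]; ring
    rw [habs] at hlt
    have hd : 0 < r * (1 - r) := mul_pos hr (by linarith)
    have h := Real.rpow_le_rpow htv0.le hlt.le hr.le
    rw [← Real.rpow_mul (div_pos hη hd).le, one_div_mul_cancel hr.ne', Real.rpow_one,
      le_div_iff₀ hd] at h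
    linarith
  · have habs : |r - 1| = 1 - r := by rw [abs_of_neg (by linarith)]; ring
    rw [habs] at hlt
    have hd : r * (1 - r) < 0 := mul_neg_of_neg_of_pos hr (by linarith)
    have h := Real.rpow_le_rpow_of_nonpos htv0 hlt.le hr.le
    rw [← Real.rpow_mul (div_pos_of_neg_of_neg hη hd).le, one_div_mul_cancel hr.ne,
      Real.rpow_one, div_le_iff_of_neg hd] at h
    linarith

/-- The scalar penalty `(t / v) ^ r - η log t` is convex on `0 < t < v (η / (r |r - 1|))^(1/r)`. -/
theorem convexOn_rpow_sub_log {r η v : ℝ} (hv : 0 < v)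
    (hcase : (0 < r ∧ r < 1 ∧ 0 < η) ∨ (r < 0 ∧ η < 0)) :
    ConvexOn ℝ (Set.Ioo 0 (v * (η / (r * |r - 1|)) ^ (1 / r)))
      fun t => (t / v) ^ r - η * Real.log t := by
  have hderiv : ∀ t : ℝ, 0 < t → HasDerivAt (fun t => (t / v) ^ r - η * Real.log t)
      (1 / v * r * (t / v) ^ (r - 1) - η * t⁻¹) t := fun t ht =>
    (((hasDerivAt_id t).div_const v).rpow_const (Or.inl (div_pos ht hv).ne')).sub
      ((Real.hasDerivAt_log ht.ne').const_mul η)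
  have hderiv2 : ∀ t : ℝ, 0 < t →
      HasDerivAt (fun t => 1 / v * r * (t / v) ^ (r - 1) - η * t⁻¹)
        (1 / v * r * (1 / v * (r - 1) * (t / v) ^ (r - 1 - 1)) - η * -(t ^ 2)⁻¹) t :=
    fun t ht =>
      ((((hasDerivAt_id t).div_const v).rpow_const (Or.inl (div_pos ht hv).ne')).const_mul _).sub
        ((hasDerivAt_inv ht.ne').const_mul η)
  refine convexOn_of_hasDerivWithinAt2_nonneg (convex_Ioo _ _)
    (fun t ht => (hderiv t ht.1).continuousAt.continuousWithinAt)
    (fun t ht => (hderiv t (interior_subset ht).1).hasDerivWithinAt)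
    (fun t ht => (hderiv2 t (interior_subset ht).1).hasDerivWithinAt) fun t ht => ?_
  obtain ⟨ht0, htv⟩ := interior_subset ht
  have hpos : 0 < t / v := div_pos ht0 hv
  have heq : 1 / v * r * (1 / v * (r - 1) * (t / v) ^ (r - 1 - 1)) - η * -(t ^ 2)⁻¹
      = (r * (r - 1) * (t / v) ^ r + η) / t ^ 2 := by
    rw [Real.rpow_sub_one hpos.ne', Real.rpow_sub_one hpos.ne']
    field_simp
    ring
  rw [heq]
  exact div_nonneg (rpow_curvature_nonneg hv ht0 hcase htv) (sq_nonneg t)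

/-- A finite sum of convex functions is convex. -/
theorem convexOn_finset_sum {E ι : Type*} [AddCommGroup E] [Module ℝ E] {s : Set E}
    (hs : Convex ℝ s) (I : Finset ι) {f : ι → E → ℝ} (hf : ∀ i ∈ I, ConvexOn ℝ s (f i)) :
    ConvexOn ℝ s fun x => ∑ i ∈ I, f i x := by
  refine ⟨hs, fun x hx y hy a b ha hb hab => ?_⟩
  simp only [Finset.smul_sum, ← Finset.sum_add_distrib]
  exact Finset.sum_le_sum fun i hi => (hf i hi).2 hx hy ha hb hab

/-- If `(0 < r < 1` and `η > 0)` or `r < 0`, the Gibbs energy functional is convex on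
the region of all `(x, θ) ∈ ℝ^N × ℝ_{++}^N` with `θᵢ < ϑᵢ (η/(r|r−1|))^{1/r}` for all `i`. -/
theorem statement1 (N M : ℕ) (hN : 0 < N) (hM : 0 < M)
    (F : Matrix (Fin M) (Fin N) ℝ) (y : Fin M → ℝ)
    (σ : ℝ) (hσ : 0 < σ)
    (r β η : ℝ) (hr0 : r ≠ 0) (hβ : 0 < β) (hη_def : η = r * β - 3 / 2)
    (vth : Fin N → ℝ) (hvth : ∀ i, 0 < vth i)
    (hcase : (0 < r ∧ r < 1 ∧ 0 < η) ∨ r < 0) :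
    ConvexOn ℝ
      {p : (Fin N → ℝ) × (Fin N → ℝ) |
        ∀ i, 0 < p.2 i ∧ p.2 i < vth i * (η / (r * |r - 1|)) ^ (1 / r)}
      (gibbsG N M F y σ r η vth) := by
  have hcase' : (0 < r ∧ r < 1 ∧ 0 < η) ∨ (r < 0 ∧ η < 0) :=
    hcase.imp_right fun hr => ⟨hr, by linarith [mul_neg_of_neg_of_pos hr hβ]⟩
  set s := {p : (Fin N → ℝ) × (Fin N → ℝ) |
    ∀ i, 0 < p.2 i ∧ p.2 i < vth i * (η / (r * |r - 1|)) ^ (1 / r)}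
  have hs : Convex ℝ s := fun p hp q hq a b ha hb hab i =>
    convex_Ioo 0 (vth i * (η / (r * |r - 1|)) ^ (1 / r)) (hp i) (hq i) ha hb hab
  have hfit : ConvexOn ℝ s fun p => ∑ j, (F.mulVec p.1 j - y j) ^ 2 := by
    refine convexOn_finset_sum hs _ fun j _ => ⟨hs, fun p _ q _ a b ha hb hab => ?_⟩
    have h := (even_two.convexOn_pow (𝕜 := ℝ)).2 (Set.mem_univ (F.mulVec p.1 j - y j))
      (Set.mem_univ (F.mulVec q.1 j - y j)) ha hb hab
    have heq : F.mulVec (a • p + b • q).1 j - y j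
        = a • (F.mulVec p.1 j - y j) + b • (F.mulVec q.1 j - y j) := by
      simp only [Prod.fst_add, Prod.smul_fst, Matrix.mulVec_add, Matrix.mulVec_smul,
        Pi.add_apply, Pi.smul_apply, smul_eq_mul]
      linear_combination y j * hab
    simp only [heq]
    exact h
  have hquad : ConvexOn ℝ s fun p => ∑ i, (p.1 i) ^ 2 / p.2 i :=
    convexOn_finset_sum hs _ fun i _ => ⟨hs, fun p hp q hq a b ha hb hab =>
      convexOn_sq_div.2 (x := (p.1 i, p.2 i)) (hp i).1 (y := (q.1 i, q.2 i)) (hq i).1 ha hb hab⟩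
  have hpen : ConvexOn ℝ s fun p => ∑ i, ((p.2 i / vth i) ^ r - η * Real.log (p.2 i)) :=
    convexOn_finset_sum hs _ fun i _ => ⟨hs, fun p hp q hq a b ha hb hab =>
      (convexOn_rpow_sub_log (hvth i) hcase').2 (hp i) (hq i) ha hb hab⟩
  refine (((hfit.smul (c := 1 / (2 * σ ^ 2)) (by positivity)).add
    (hquad.smul (c := 1 / 2) (by norm_num))).add hpen).congr fun p _ => ?_
  simp only [gibbsG, Pi.add_apply, smul_eq_mul, Finset.sum_sub_distrib, Finset.mul_sum]
  ring
end

section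
/- Suppose r ≥ 1 and η = rβ − 3/2 > 0. Then the Gibbs energy functional G attains a unique global minimizer (x*, θ*) over ℝ^N × ℝ_{++}^N, and any sequence (x^{(k)}, θ^{(k)}) in ℝ^N × ℝ_{++}^N satisfying the exact alternating minimization conditions — for every k, θ^{(k+1)} minimizes θ ↦ G(x^{(k)}, θ) over ℝ_{++}^N and x^{(k+1)} minimizes x ↦ G(x, θ^{(k+1)}) over ℝ^N — converges to (x*, θ*) as k → ∞. -/
open Real Filter

open scoped Topology

/-- For a convex function on a product, a point of differentiability that is a local minimum in
each of the two blocks separately is a global minimum. -/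
theorem ConvexOn.isMinOn_of_isLocalMin_blocks {E₁ E₂ : Type*}
    [NormedAddCommGroup E₁] [NormedSpace ℝ E₁] [NormedAddCommGroup E₂] [NormedSpace ℝ E₂]
    {f : E₁ × E₂ → ℝ} {s : Set (E₁ × E₂)} (hf : ConvexOn ℝ s f) {p : E₁ × E₂} (hp : p ∈ s)
    (hd : DifferentiableAt ℝ f p)
    (h₁ : IsLocalMin (fun x => f (x, p.2)) p.1) (h₂ : IsLocalMin (fun z => f (p.1, z)) p.2) :
    IsMinOn f s p := by
  have hD := hd.hasFDerivAt
  have e₁ : (fderiv ℝ f p).comp (.inl ℝ E₁ E₂) = 0 :=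
    h₁.hasFDerivAt_eq_zero (HasFDerivAt.comp p.1 (g := f) (f := fun x => (x, p.2)) hD
      (hasFDerivAt_prodMk_left p.1 p.2))
  have e₂ : (fderiv ℝ f p).comp (.inr ℝ E₁ E₂) = 0 :=
    h₂.hasFDerivAt_eq_zero (HasFDerivAt.comp p.2 (g := f) (f := fun z => (p.1, z)) hD
      (hasFDerivAt_prodMk_right p.1 p.2))
  have hzero : fderiv ℝ f p = 0 := by
    ext v
    · simpa using DFunLike.congr_fun e₁ v
    · simpa using DFunLike.congr_fun e₂ v
  intro q hq
  have hline : HasDerivAt (AffineMap.lineMap p q : ℝ → E₁ × E₂) (q - p) 0 :=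
    AffineMap.hasDerivAt_lineMap
  have hD' : HasFDerivAt f (0 : E₁ × E₂ →L[ℝ] ℝ) (AffineMap.lineMap p q (0 : ℝ)) := by
    rw [AffineMap.lineMap_apply_zero, ← hzero]
    exact hD
  have hderiv := hD'.comp_hasDerivAt (0 : ℝ) hline
  have hconv := hf.comp_affineMap (AffineMap.lineMap p q : ℝ →ᵃ[ℝ] E₁ × E₂)
  have hslope := hconv.le_slope_of_hasDerivAt (x := 0) (y := 1) (by simpa using hp)
    (by simpa using hq) one_pos hderiv
  simpa [slope_def_field] using hslope

/-- Iterates of exact alternating minimization that stay in a compact set converge, provided that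
the objective has only one blockwise minimizer. -/
theorem tendsto_of_alternating_minimization {E₁ E₂ : Type*} [TopologicalSpace E₁]
    [TopologicalSpace E₂] [FirstCountableTopology E₁] [FirstCountableTopology E₂]
    {f : E₁ × E₂ → ℝ} {s : Set E₂} {K : Set (E₁ × E₂)} {p : E₁ × E₂}
    {x : ℕ → E₁} {z : ℕ → E₂}
    (hf : ∀ q : E₁ × E₂, q.2 ∈ s → ContinuousAt f q) (hK : IsCompact K)
    (hKs : ∀ q ∈ K, q.2 ∈ s) (hmem : ∀ k, (x k, z (k + 1)) ∈ K)
    (hz : ∀ k, ∀ z' ∈ s, f (x k, z (k + 1)) ≤ f (x k, z'))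
    (hx : ∀ k x', f (x (k + 1), z (k + 1)) ≤ f (x', z (k + 1)))
    (hp : ∀ q : E₁ × E₂, q.2 ∈ s → (∀ x', f q ≤ f (x', q.2)) → (∀ z' ∈ s, f q ≤ f (q.1, z')) →
      q = p) :
    Tendsto (fun k => (x k, z k)) atTop (𝓝 p) := by
  have hzs : ∀ k, z (k + 1) ∈ s := fun k => hKs _ (hmem k)
  have hstep : ∀ k, f (x (k + 1), z (k + 2)) ≤ f (x (k + 1), z (k + 1)) :=
    fun k => hz (k + 1) _ (hzs k)
  have hanti : Antitone fun k => f (x k, z (k + 1)) :=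
    antitone_nat_of_succ_le fun k => (hstep k).trans (hx k _)
  have hlim : Tendsto (fun k => (x k, z (k + 1))) atTop (𝓝 p) := by
    refine hK.tendsto_nhds_of_unique_mapClusterPt (.of_forall hmem) fun q hqK hq => ?_
    obtain ⟨ψ, hψ, hψq⟩ := hq.tendsto_subseq
    have hqs := hKs q hqK
    have hval : Tendsto (fun n => f (x (ψ n), z (ψ n + 1))) atTop (𝓝 (f q)) :=
      (hf q hqs).tendsto.comp hψq
    have hge : ∀ k, f q ≤ f (x k, z (k + 1)) := fun k =>
      le_of_tendsto hval <| (hψ.tendsto_atTop.eventually_ge_atTop k).mono fun n hn => hanti hn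
    have hψ₁ : Tendsto (fun n => x (ψ n)) atTop (𝓝 q.1) := (continuous_fst.tendsto q).comp hψq
    have hψ₂ : Tendsto (fun n => z (ψ n + 1)) atTop (𝓝 q.2) := (continuous_snd.tendsto q).comp hψq
    refine hp q hqs (fun x' => ?_) fun z' hz' => ?_
    · have h : Tendsto (fun n => f (x', z (ψ n + 1))) atTop (𝓝 (f (x', q.2))) :=
        (hf (x', q.2) hqs).tendsto.comp (tendsto_const_nhds.prodMk_nhds hψ₂)
      exact ge_of_tendsto' h fun n => (hge _).trans ((hstep _).trans (hx _ x'))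
    · have h : Tendsto (fun n => f (x (ψ n), z')) atTop (𝓝 (f (q.1, z'))) :=
        (hf (q.1, z') hz').tendsto.comp (hψ₁.prodMk_nhds tendsto_const_nhds)
      exact le_of_tendsto_of_tendsto' hval h fun n => hz _ z' hz'
  exact ((continuous_fst.tendsto p).comp hlim).prodMk_nhds
    ((tendsto_add_atTop_iff_nat 1).1 ((continuous_snd.tendsto p).comp hlim))

/-- The contribution of one coordinate to the Gibbs energy, data misfit excluded. -/
noncomputable def gibbsTerm (r η c : ℝ) (p : ℝ × ℝ) : ℝ :=
  1 / 2 * (p.1 ^ 2 / p.2) + (p.2 / c) ^ r - η * log p.2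

theorem gibbsG_eq (N M : ℕ) (F : Matrix (Fin M) (Fin N) ℝ) (y : Fin M → ℝ) (σ r η : ℝ)
    (vth : Fin N → ℝ) (p : (Fin N → ℝ) × (Fin N → ℝ)) :
    gibbsG N M F y σ r η vth p = 1 / (2 * σ ^ 2) * ∑ j, (F.mulVec p.1 j - y j) ^ 2
      + ∑ i, gibbsTerm r η (vth i) (p.1 i, p.2 i) := by
  simp only [gibbsG, gibbsTerm, Finset.sum_sub_distrib, Finset.sum_add_distrib, Finset.mul_sum]
  ring

/-- The defect in the joint convexity inequality of `x ^ 2 / t`. -/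
theorem sq_div_convexity_defect {x x' t t' a b : ℝ} (ht : 0 < t) (ht' : 0 < t') (ha : 0 < a)
    (hb : 0 < b) :
    a * (x ^ 2 / t) + b * (x' ^ 2 / t') - (a * x + b * x') ^ 2 / (a * t + b * t')
      = a * b * (x * t' - x' * t) ^ 2 / (t * t' * (a * t + b * t')) := by
  have : a * t + b * t' ≠ 0 := by positivity
  field_simp
  ring

theorem strictConvexOn_gibbsTerm {r η c : ℝ} (hr : 1 ≤ r) (hη : 0 < η) (hc : 0 < c) :
    StrictConvexOn ℝ {p : ℝ × ℝ | 0 < p.2} (gibbsTerm r η c) := by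
  refine ⟨(convex_Ioi (0 : ℝ)).linear_preimage (LinearMap.snd ℝ ℝ ℝ), ?_⟩
  rintro ⟨x, t⟩ (ht : 0 < t) ⟨x', t'⟩ (ht' : 0 < t') hne a b ha hb hab
  have hpow := (convexOn_rpow hr).2 (x := t / c) (y := t' / c) (div_pos ht hc).le
    (div_pos ht' hc).le ha.le hb.le hab
  have hdiv : (a * t + b * t') / c = a * (t / c) + b * (t' / c) := by ring
  have hdefect := sq_div_convexity_defect (x := x) (x' := x') ht ht' ha hb
  simp only [gibbsTerm, Prod.smul_mk, Prod.mk_add_mk, smul_eq_mul, hdiv] at hpow ⊢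
  by_cases htt : t = t'
  · subst htt
    have hxx : x - x' ≠ 0 := fun h => hne (by rw [sub_eq_zero.1 h])
    have hsq : 0 < a * b * (x * t - x' * t) ^ 2 / (t * t * (a * t + b * t)) := by
      rw [← sub_mul]
      positivity
    have hlog : log (a * t + b * t) = a * log t + b * log t := by
      rw [← add_mul, ← add_mul, hab, one_mul, one_mul]
    rw [hlog]
    linarith
  · have hsq : 0 ≤ a * b * (x * t' - x' * t) ^ 2 / (t * t' * (a * t + b * t')) := by positivity
    have hlog := strictConcaveOn_log_Ioi.2 ht ht' htt ha hb hab
    simp only [smul_eq_mul] at hlog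
    have := mul_lt_mul_of_pos_left hlog hη
    linarith

theorem strictConvexOn_gibbsG {N M : ℕ} (F : Matrix (Fin M) (Fin N) ℝ) (y : Fin M → ℝ)
    (σ : ℝ) {r η : ℝ} {vth : Fin N → ℝ} (hr : 1 ≤ r) (hη : 0 < η) (hvth : ∀ i, 0 < vth i) :
    StrictConvexOn ℝ {p : (Fin N → ℝ) × (Fin N → ℝ) | ∀ i, 0 < p.2 i}
      (gibbsG N M F y σ r η vth) := by
  have hs : Convex ℝ {p : (Fin N → ℝ) × (Fin N → ℝ) | ∀ i, 0 < p.2 i} := by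
    intro p hp q hq a b ha hb hab i
    exact convex_Ioi (0 : ℝ) (hp i) (hq i) ha hb hab
  refine ⟨hs, fun p hp q hq hne a b ha hb hab => ?_⟩
  have hfit : ∑ j, (F.mulVec (a • p + b • q).1 j - y j) ^ 2
      ≤ a * ∑ j, (F.mulVec p.1 j - y j) ^ 2 + b * ∑ j, (F.mulVec q.1 j - y j) ^ 2 := by
    rw [Finset.mul_sum, Finset.mul_sum, ← Finset.sum_add_distrib]
    refine Finset.sum_le_sum fun j _ => ?_
    have hcomb : F.mulVec (a • p + b • q).1 j - y j
        = a * (F.mulVec p.1 j - y j) + b * (F.mulVec q.1 j - y j) := by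
      simp only [Prod.fst_add, Prod.smul_fst, Matrix.mulVec_add, Matrix.mulVec_smul,
        Pi.add_apply, Pi.smul_apply, smul_eq_mul]
      linear_combination y j * hab
    rw [hcomb]
    exact (even_two.convexOn_pow (𝕜 := ℝ)).2 (Set.mem_univ _) (Set.mem_univ _) ha.le hb.le hab
  have hterm : ∑ i, gibbsTerm r η (vth i) ((a • p + b • q).1 i, (a • p + b • q).2 i)
      < a * ∑ i, gibbsTerm r η (vth i) (p.1 i, p.2 i)
        + b * ∑ i, gibbsTerm r η (vth i) (q.1 i, q.2 i) := by
    rw [Finset.mul_sum, Finset.mul_sum, ← Finset.sum_add_distrib]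
    obtain ⟨i, hi⟩ : ∃ i, (p.1 i, p.2 i) ≠ (q.1 i, q.2 i) := by
      by_contra! h
      exact hne (Prod.ext (funext fun i => congrArg Prod.fst (h i))
        (funext fun i => congrArg Prod.snd (h i)))
    refine Finset.sum_lt_sum (fun i _ => ?_) ⟨i, Finset.mem_univ i, ?_⟩
    · exact (strictConvexOn_gibbsTerm hr hη (hvth i)).convexOn.2 (x := (p.1 i, p.2 i))
        (y := (q.1 i, q.2 i)) (hp i) (hq i) ha.le hb.le hab
    · exact (strictConvexOn_gibbsTerm hr hη (hvth i)).2 (x := (p.1 i, p.2 i))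
        (y := (q.1 i, q.2 i)) (hp i) (hq i) hi ha hb hab
  have hσ : 0 ≤ 1 / (2 * σ ^ 2) := by positivity
  have := mul_le_mul_of_nonneg_left hfit hσ
  simp only [gibbsG_eq, smul_eq_mul]
  linarith

theorem differentiableAt_gibbsG {N M : ℕ} (F : Matrix (Fin M) (Fin N) ℝ) (y : Fin M → ℝ)
    (σ r η : ℝ) {vth : Fin N → ℝ} (hvth : ∀ i, 0 < vth i) {p : (Fin N → ℝ) × (Fin N → ℝ)}
    (hp : ∀ i, 0 < p.2 i) : DifferentiableAt ℝ (gibbsG N M F y σ r η vth) p := by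
  have hp' : ∀ i, p.2 i ≠ 0 := fun i => (hp i).ne'
  have hscaled : ∀ i, p.2 i * (vth i)⁻¹ ≠ 0 := fun i =>
    (mul_pos (hp i) (inv_pos.2 (hvth i))).ne'
  have hx : ∀ i, DifferentiableAt ℝ (fun q : (Fin N → ℝ) × (Fin N → ℝ) => q.1 i) p :=
    fun i => by fun_prop
  have hz : ∀ i, DifferentiableAt ℝ (fun q : (Fin N → ℝ) × (Fin N → ℝ) => q.2 i) p :=
    fun i => by fun_prop
  have hF : ∀ j, DifferentiableAt ℝ
      (fun q : (Fin N → ℝ) × (Fin N → ℝ) => F.mulVec q.1 j) p := fun j => by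
    simp only [Matrix.mulVec, dotProduct]
    fun_prop
  unfold gibbsG
  refine ((DifferentiableAt.add (.add (.const_mul (.fun_sum fun j _ => ?_) _)
    (.const_mul (.fun_sum fun i _ => ?_) _)) (.fun_sum fun i _ => ?_))).sub
    (.const_mul (.fun_sum fun i _ => ?_) _)
  · exact ((hF j).sub_const _).pow 2
  · simp only [div_eq_mul_inv]
    exact ((hx i).fun_pow 2).fun_mul ((hz i).fun_inv (hp' i))
  · simp only [div_eq_mul_inv]
    exact ((hz i).mul_const _).rpow_const (.inl (hscaled i))
  · exact (hz i).log (hp' i)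

/-- Lower bound of one coordinate's energy exhibiting its growth as `t → ∞`. -/
theorem gibbsTerm_lower_bound {r η c : ℝ} (hr : 1 ≤ r) (hη : 0 < η) (hc : 0 < c) (x : ℝ) {t : ℝ}
    (ht : 0 < t) :
    1 / 2 * (x ^ 2 / t) + t / (2 * c) + (η - 1 - η * log (2 * η * c)) ≤ gibbsTerm r η c (x, t) := by
  have hu : 0 < t / c := div_pos ht hc
  have hpow : t / c - 1 ≤ (t / c) ^ r := by
    rcases le_total 1 (t / c) with h | h
    · have := rpow_le_rpow_of_exponent_le h hr
      rw [rpow_one] at this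
      linarith
    · linarith [rpow_nonneg hu.le r]
  have hlog : η * log t ≤ t / (2 * c) - η + η * log (2 * η * c) := by
    have hs : 0 < 2 * η * c := by positivity
    have h := log_le_sub_one_of_pos (div_pos ht hs)
    rw [log_div ht.ne' hs.ne'] at h
    have h' := mul_le_mul_of_nonneg_left h hη.le
    have e : η * (t / (2 * η * c) - 1) = t / (2 * c) - η := by field_simp
    linarith
  have e : t / c = t / (2 * c) + t / (2 * c) := by field_simp; norm_num
  simp only [gibbsTerm]
  linarith

/-- The sublevel sets of the Gibbs energy lie in compact boxes inside the domain. -/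
theorem exists_isCompact_sublevel_gibbsG {N M : ℕ} (F : Matrix (Fin M) (Fin N) ℝ)
    (y : Fin M → ℝ) (σ : ℝ) {r η : ℝ} {vth : Fin N → ℝ} (hr : 1 ≤ r) (hη : 0 < η)
    (hvth : ∀ i, 0 < vth i) (A : ℝ) :
    ∃ K : Set ((Fin N → ℝ) × (Fin N → ℝ)), IsCompact K ∧ (∀ q ∈ K, ∀ i, 0 < q.2 i) ∧
      ∀ q : (Fin N → ℝ) × (Fin N → ℝ), (∀ i, 0 < q.2 i) → gibbsG N M F y σ r η vth q ≤ A →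
        q ∈ K := by
  set C : Fin N → ℝ := fun i => η - 1 - η * log (2 * η * vth i) with hC
  set E : ℝ := A - ∑ i, C i
  set R : Fin N → ℝ := fun i => √(4 * vth i * E ^ 2)
  set l : Fin N → ℝ := fun i => exp (-(E + C i) / η)
  set u : Fin N → ℝ := fun i => 2 * vth i * E
  refine ⟨Set.Icc (-R, l) (R, u), isCompact_Icc, fun q hq i => (exp_pos _).trans_le (hq.1.2 i),
    fun q hq hqA => ?_⟩
  have hlow : ∀ i, 1 / 2 * (q.1 i ^ 2 / q.2 i) + q.2 i / (2 * vth i)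
      ≤ gibbsTerm r η (vth i) (q.1 i, q.2 i) - C i := fun i => by
    have := gibbsTerm_lower_bound hr hη (hvth i) (q.1 i) (hq i)
    simp only [hC]
    linarith
  have hsq : ∀ i, 0 ≤ q.1 i ^ 2 / q.2 i := fun i => div_nonneg (sq_nonneg _) (hq i).le
  have hlin : ∀ i, 0 < q.2 i / (2 * vth i) := fun i =>
    div_pos (hq i) (mul_pos two_pos (hvth i))
  have hterm : ∀ i, gibbsTerm r η (vth i) (q.1 i, q.2 i) - C i ≤ E := fun i => by
    have h := Finset.single_le_sum (f := fun i => gibbsTerm r η (vth i) (q.1 i, q.2 i) - C i)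
      (fun j _ => by linarith [hlow j, hsq j, hlin j]) (Finset.mem_univ i)
    have hfit : 0 ≤ 1 / (2 * σ ^ 2) * ∑ j, (F.mulVec q.1 j - y j) ^ 2 := by positivity
    rw [gibbsG_eq] at hqA
    simp only [Finset.sum_sub_distrib] at h
    linarith
  have hup : ∀ i, q.2 i ≤ u i := fun i => by
    have h : q.2 i / (2 * vth i) ≤ E := by linarith [hlow i, hsq i, hterm i]
    rw [div_le_iff₀ (mul_pos two_pos (hvth i))] at h
    simp only [u]
    linarith
  have hlo : ∀ i, l i ≤ q.2 i := fun i => by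
    have h := hterm i
    have hpow : 0 ≤ (q.2 i / vth i) ^ r := rpow_nonneg (div_pos (hq i) (hvth i)).le r
    simp only [gibbsTerm] at h
    rw [← le_log_iff_exp_le (hq i), div_le_iff₀ hη]
    linarith [hsq i]
  have habs : ∀ i, |q.1 i| ≤ R i := fun i => by
    refine abs_le_sqrt ?_
    have hE0 : 0 ≤ E := by linarith [hlow i, hsq i, hlin i, hterm i]
    have h : q.1 i ^ 2 / q.2 i ≤ 2 * E := by linarith [hlow i, hlin i, hterm i]
    rw [div_le_iff₀ (hq i)] at h
    have := mul_le_mul_of_nonneg_left (hup i) (mul_nonneg zero_le_two hE0)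
    simp only [u] at this
    linarith
  exact ⟨⟨fun i => (abs_le.1 (habs i)).1, hlo⟩, ⟨fun i => (abs_le.1 (habs i)).2, hup⟩⟩

/-- If `r ≥ 1` and `η = rβ − 3/2 > 0`, then `G` attains a unique global minimizer
`(x*, θ*)` over `ℝ^N × ℝ_{++}^N`, and any sequence of exact alternating (IAS)
minimization iterates converges to `(x*, θ*)`. -/
theorem statement2 (N M : ℕ) (hN : 0 < N) (hM : 0 < M)
    (F : Matrix (Fin M) (Fin N) ℝ) (y : Fin M → ℝ)
    (σ : ℝ) (hσ : 0 < σ)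
    (r β η : ℝ) (hr0 : r ≠ 0) (hβ : 0 < β) (hη_def : η = r * β - 3 / 2)
    (vth : Fin N → ℝ) (hvth : ∀ i, 0 < vth i)
    (hr : 1 ≤ r) (hη : 0 < η) :
    ∃ p : (Fin N → ℝ) × (Fin N → ℝ),
      (∀ i, 0 < p.2 i) ∧
      (∀ q : (Fin N → ℝ) × (Fin N → ℝ), (∀ i, 0 < q.2 i) →
        gibbsG N M F y σ r η vth p ≤ gibbsG N M F y σ r η vth q) ∧
      (∀ q : (Fin N → ℝ) × (Fin N → ℝ), (∀ i, 0 < q.2 i) → q ≠ p →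
        gibbsG N M F y σ r η vth p < gibbsG N M F y σ r η vth q) ∧
      (∀ x θ : ℕ → Fin N → ℝ,
        (∀ k i, 0 < θ k i) →
        (∀ k, ∀ θ' : Fin N → ℝ, (∀ i, 0 < θ' i) →
          gibbsG N M F y σ r η vth (x k, θ (k + 1)) ≤ gibbsG N M F y σ r η vth (x k, θ')) →
        (∀ k, ∀ x' : Fin N → ℝ,
          gibbsG N M F y σ r η vth (x (k + 1), θ (k + 1)) ≤
            gibbsG N M F y σ r η vth (x', θ (k + 1))) →
        Tendsto (fun k => (x k, θ k)) atTop (nhds p)) := by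
  have hconv := strictConvexOn_gibbsG F y σ hr hη hvth
  have hdiff : ∀ q : (Fin N → ℝ) × (Fin N → ℝ), (∀ i, 0 < q.2 i) →
      DifferentiableAt ℝ (gibbsG N M F y σ r η vth) q := fun q hq =>
    differentiableAt_gibbsG F y σ r η hvth hq
  obtain ⟨p, hp, hmin⟩ : ∃ p : (Fin N → ℝ) × (Fin N → ℝ), (∀ i, 0 < p.2 i) ∧
      ∀ q : (Fin N → ℝ) × (Fin N → ℝ), (∀ i, 0 < q.2 i) →
        gibbsG N M F y σ r η vth p ≤ gibbsG N M F y σ r η vth q := by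
    obtain ⟨K, hK, hKpos, hsub⟩ := exists_isCompact_sublevel_gibbsG F y σ hr hη hvth
      (gibbsG N M F y σ r η vth (0, fun _ => 1))
    have h1 := hsub (0, fun _ => 1) (fun _ => one_pos) le_rfl
    obtain ⟨p, hpK, hpmin⟩ := hK.exists_isMinOn ⟨_, h1⟩
      fun q hq => (hdiff q (hKpos q hq)).continuousAt.continuousWithinAt
    refine ⟨p, hKpos p hpK, fun q hq => ?_⟩
    rcases le_total (gibbsG N M F y σ r η vth q) (gibbsG N M F y σ r η vth (0, fun _ => 1))
      with h | h
    · exact hpmin (hsub q hq h)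
    · exact (hpmin h1).trans h
  have huniq : ∀ q : (Fin N → ℝ) × (Fin N → ℝ), (∀ i, 0 < q.2 i) →
      gibbsG N M F y σ r η vth q ≤ gibbsG N M F y σ r η vth p → q = p := fun q hq hle =>
    hconv.eq_of_isMinOn (fun q' hq' => hle.trans (hmin q' hq')) (fun q' hq' => hmin q' hq') hq hp
  refine ⟨p, hp, hmin, fun q hq hne => lt_of_not_ge fun hle => hne (huniq q hq hle),
    fun x θ hθpos hθmin hxmin => ?_⟩
  obtain ⟨K, hK, hKpos, hsub⟩ := exists_isCompact_sublevel_gibbsG F y σ hr hη hvth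
    (gibbsG N M F y σ r η vth (x 0, θ 1))
  have hanti : Antitone fun k => gibbsG N M F y σ r η vth (x k, θ (k + 1)) :=
    antitone_nat_of_succ_le fun k => (hθmin (k + 1) _ (hθpos _)).trans (hxmin k _)
  refine tendsto_of_alternating_minimization (s := {z : Fin N → ℝ | ∀ i, 0 < z i})
    (fun q hq => (hdiff q hq).continuousAt) hK hKpos
    (fun k => hsub _ (hθpos _) (hanti (Nat.zero_le k))) hθmin hxmin fun q hq hq₁ hq₂ => ?_
  refine huniq q hq (hconv.convexOn.isMinOn_of_isLocalMin_blocks hq (hdiff q hq)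
    (.of_forall hq₁) ?_ hp)
  have hopen : IsOpen {z : Fin N → ℝ | ∀ i, 0 < z i} := by
    simp only [Set.ofPred_forall]
    exact isOpen_iInter_of_finite fun i => isOpen_lt continuous_const (continuous_apply i)
  exact Filter.mem_of_superset (hopen.mem_nhds hq) hq₂
end

section
/- Assume either (r > 0 and η = rβ − 3/2 > 0) or (r < 0 and η < −3/2). Let (x^{(k)}, θ^{(k)}) be a sequence in ℝ^N × ℝ_{++}^N satisfying, for every k: θ^{(k+1)} minimizes θ ↦ G(x^{(k)}, θ) over ℝ_{++}^N and x^{(k+1)} minimizes x ↦ G(x, θ^{(k+1)}) over ℝ^N. Then the sequence (x^{(k)}, θ^{(k)}) is bounded, and every limit point (x*, θ*) of the sequence is a coordinate-wise minimizer of G, i.e., θ* minimizes θ ↦ G(x*, θ) over ℝ_{++}^N and x* minimizes x ↦ G(x, θ*) over ℝ^N. -/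
open Real Filter

/-- Coercivity of the one-dimensional penalty: when `r` and `η` have the same sign, it dominates a
positive multiple of `|log t|`. -/
lemma exists_mul_abs_log_sub_le_penalty {r η v : ℝ} (hr : r ≠ 0) (hκ : 0 < η / r) (hv : 0 < v) :
    ∃ D, ∀ t, 0 < t → |η| * |log t| - D ≤ (t / v) ^ r - η * log t := by
  set κ := η / r with hκdef
  have hη : η = κ * r := by rw [hκdef]; field_simp
  refine ⟨|2 * κ - 2 * κ * log (2 * κ)| + |η| * |log v| + η * log v, fun t ht => ?_⟩
  have hlog : log (t / v) = log t - log v := log_div ht.ne' hv.ne'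
  obtain ⟨w, hw⟩ : ∃ w, w = r * (log t - log v) := ⟨_, rfl⟩
  have hpow : (t / v) ^ r = exp w := by
    rw [rpow_def_of_pos (div_pos ht hv), hlog, hw, mul_comm]
  have hκw : κ * w = η * (log t - log v) := by rw [hw, hη]; ring
  have habs : |η| * |log t| ≤ κ * |w| + |η| * |log v| := by
    have h : κ * |w| = |η| * |log t - log v| := by
      rw [← abs_mul, ← hκw, abs_mul, abs_of_pos hκ]
    have htri : |log t| ≤ |log t - log v| + |log v| := by
      simpa using abs_add_le (log t - log v) (log v)
    rw [h]
    nlinarith [mul_le_mul_of_nonneg_left htri (abs_nonneg η)]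
  have hmain : κ * |w| - |2 * κ - 2 * κ * log (2 * κ)| ≤ exp w - κ * w := by
    rcases le_total w 0 with h | h
    · rw [abs_of_nonpos h]
      linarith [exp_pos w, abs_nonneg (2 * κ - 2 * κ * log (2 * κ))]
    · rw [abs_of_nonneg h]
      have htan : 2 * κ * (w - log (2 * κ) + 1) ≤ exp w := by
        have hexp : exp w = 2 * κ * exp (w - log (2 * κ)) := by
          rw [exp_sub, exp_log (by positivity)]
          field_simp
        rw [hexp]
        exact mul_le_mul_of_nonneg_left (add_one_le_exp _) (by positivity)
      linarith [neg_abs_le (2 * κ - 2 * κ * log (2 * κ))]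
  rw [hpow]
  linarith

/-- The sublevel sets of `gibbsG` are bounded, and bounded away from the boundary in `θ`. -/
lemma exists_bounds_of_gibbsG_le {N M : ℕ} (F : Matrix (Fin M) (Fin N) ℝ) (y : Fin M → ℝ)
    (σ : ℝ) {r η : ℝ} {vth : Fin N → ℝ} (hr : r ≠ 0) (hκ : 0 < η / r)
    (hvth : ∀ i, 0 < vth i) (C : ℝ) :
    ∃ a b B : ℝ, 0 < a ∧ ∀ x θ : Fin N → ℝ, (∀ i, 0 < θ i) →
      gibbsG N M F y σ r η vth (x, θ) ≤ C → ∀ i, a ≤ θ i ∧ θ i ≤ b ∧ |x i| ≤ B := by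
  choose D hD using fun i => exists_mul_abs_log_sub_le_penalty hr hκ (hvth i)
  have hη : 0 < |η| := abs_pos.2 fun h => by simp [h] at hκ
  set K := C + ∑ i, D i
  set L := K / |η| with hL
  refine ⟨exp (-L), exp L, √(2 * K * exp L), exp_pos _, fun x θ hθ hG i => ?_⟩
  have hres : 0 ≤ (1 / (2 * σ ^ 2)) * ∑ j, (F.mulVec x j - y j) ^ 2 := by positivity
  have hquad : x i ^ 2 / θ i ≤ ∑ i, x i ^ 2 / θ i :=
    Finset.single_le_sum (f := fun i => x i ^ 2 / θ i)
      (fun j _ => div_nonneg (sq_nonneg _) (hθ j).le) (Finset.mem_univ i)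
  have hlog : |η| * |log (θ i)| ≤ ∑ i, |η| * |log (θ i)| :=
    Finset.single_le_sum (f := fun i => |η| * |log (θ i)|)
      (fun j _ => by positivity) (Finset.mem_univ i)
  have hpen : ∑ i, |η| * |log (θ i)| - ∑ i, D i ≤
      ∑ i, (θ i / vth i) ^ r - η * ∑ i, log (θ i) := by
    rw [Finset.mul_sum, ← Finset.sum_sub_distrib, ← Finset.sum_sub_distrib]
    exact Finset.sum_le_sum fun j _ => hD j _ (hθ j)
  have hquad0 : 0 ≤ x i ^ 2 / θ i := div_nonneg (sq_nonneg _) (hθ i).le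
  have hlog0 : 0 ≤ |η| * |log (θ i)| := by positivity
  simp only [gibbsG] at hG
  have hlogK : |η| * |log (θ i)| ≤ K := by linarith
  have hquadK : x i ^ 2 / θ i ≤ 2 * K := by linarith
  have hK0 : 0 ≤ K := hlog0.trans hlogK
  have hlogL : |log (θ i)| ≤ L := by
    rw [hL, le_div_iff₀ hη]
    linarith
  have hlow := (abs_le.1 hlogL).1
  have hup := (abs_le.1 hlogL).2
  have hle : θ i ≤ exp L := (log_le_iff_le_exp (hθ i)).1 hup
  refine ⟨(le_log_iff_exp_le (hθ i)).1 hlow, hle, abs_le_sqrt ?_⟩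
  rw [div_le_iff₀ (hθ i)] at hquadK
  exact hquadK.trans (mul_le_mul_of_nonneg_left hle (by positivity))

/-- `gibbsG` is continuous at every point with positive `θ`. -/
lemma continuousAt_gibbsG {N M : ℕ} (F : Matrix (Fin M) (Fin N) ℝ) (y : Fin M → ℝ)
    (σ r η : ℝ) {vth : Fin N → ℝ} (hvth : ∀ i, 0 < vth i) {p : (Fin N → ℝ) × (Fin N → ℝ)}
    (hp : ∀ i, 0 < p.2 i) : ContinuousAt (gibbsG N M F y σ r η vth) p := by
  have hx : ∀ i, ContinuousAt (fun q : (Fin N → ℝ) × (Fin N → ℝ) => q.1 i) p := fun i => by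
    fun_prop
  have hθ : ∀ i, ContinuousAt (fun q : (Fin N → ℝ) × (Fin N → ℝ) => q.2 i) p := fun i => by
    fun_prop
  have hres : Continuous fun q : (Fin N → ℝ) × (Fin N → ℝ) =>
      (1 / (2 * σ ^ 2)) * ∑ j, (F.mulVec q.1 j - y j) ^ 2 := by
    simp only [Matrix.mulVec, dotProduct]
    fun_prop
  have hquad : ContinuousAt (fun q : (Fin N → ℝ) × (Fin N → ℝ) => ∑ i, q.1 i ^ 2 / q.2 i) p :=
    tendsto_finsetSum _ fun i _ => ((hx i).pow 2).div (hθ i) (hp i).ne'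
  have hpow : ContinuousAt
      (fun q : (Fin N → ℝ) × (Fin N → ℝ) => ∑ i, (q.2 i / vth i) ^ r) p :=
    tendsto_finsetSum _ fun i _ =>
      ((hθ i).div_const (vth i)).rpow_const (Or.inl (div_pos (hp i) (hvth i)).ne')
  have hlog : ContinuousAt (fun q : (Fin N → ℝ) × (Fin N → ℝ) => ∑ i, log (q.2 i)) p :=
    tendsto_finsetSum _ fun i _ => (hθ i).log (hp i).ne'
  exact ((hres.continuousAt.add (hquad.const_mul (1 / 2))).add hpow).sub (hlog.const_mul η)

/-- Any sequence of exact alternating (IAS) minimization iterates is bounded, and every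
limit point is a coordinate-wise minimizer of `G`. -/
theorem statement3 (N M : ℕ) (hN : 0 < N) (hM : 0 < M)
    (F : Matrix (Fin M) (Fin N) ℝ) (y : Fin M → ℝ)
    (σ : ℝ) (hσ : 0 < σ)
    (r β η : ℝ) (hr0 : r ≠ 0) (hβ : 0 < β) (hη_def : η = r * β - 3 / 2)
    (vth : Fin N → ℝ) (hvth : ∀ i, 0 < vth i)
    (hcase : (0 < r ∧ 0 < η) ∨ (r < 0 ∧ η < -(3 / 2)))
    (x θ : ℕ → Fin N → ℝ)
    (hθpos : ∀ k i, 0 < θ k i)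
    (hθmin : ∀ k, ∀ θ' : Fin N → ℝ, (∀ i, 0 < θ' i) →
      gibbsG N M F y σ r η vth (x k, θ (k + 1)) ≤ gibbsG N M F y σ r η vth (x k, θ'))
    (hxmin : ∀ k, ∀ x' : Fin N → ℝ,
      gibbsG N M F y σ r η vth (x (k + 1), θ (k + 1)) ≤
        gibbsG N M F y σ r η vth (x', θ (k + 1))) :
    Bornology.IsBounded (Set.range fun k => (x k, θ k)) ∧
    ∀ p : (Fin N → ℝ) × (Fin N → ℝ),
      MapClusterPt p atTop (fun k => (x k, θ k)) →
      (∀ i, 0 < p.2 i) ∧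
      (∀ θ' : Fin N → ℝ, (∀ i, 0 < θ' i) →
        gibbsG N M F y σ r η vth p ≤ gibbsG N M F y σ r η vth (p.1, θ')) ∧
      (∀ x' : Fin N → ℝ,
        gibbsG N M F y σ r η vth p ≤ gibbsG N M F y σ r η vth (x', p.2)) := by
  have hκ : 0 < η / r := by
    rcases hcase with ⟨h₁, h₂⟩ | ⟨h₁, h₂⟩
    · exact div_pos h₂ h₁
    · exact div_pos_of_neg_of_neg (by linarith) h₁
  have hanti : Antitone fun k => gibbsG N M F y σ r η vth (x k, θ k) :=
    antitone_nat_of_succ_le fun k => (hxmin k (x k)).trans (hθmin k (θ k) (hθpos k))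
  obtain ⟨a, b, B, ha, hbd⟩ := exists_bounds_of_gibbsG_le F y σ hr0 hκ hvth
    (gibbsG N M F y σ r η vth (x 0, θ 0))
  have hiter : ∀ k i, a ≤ θ k i ∧ θ k i ≤ b ∧ |x k i| ≤ B := fun k =>
    hbd (x k) (θ k) (hθpos k) (hanti (Nat.zero_le k))
  refine ⟨?_, fun p hp => ?_⟩
  · refine (Metric.isBounded_Icc
      ((fun _ => -B, fun _ => a) : (Fin N → ℝ) × (Fin N → ℝ)) (fun _ => B, fun _ => b)).subset ?_
    rintro _ ⟨k, rfl⟩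
    exact ⟨⟨fun i => (abs_le.1 (hiter k i).2.2).1, fun i => (hiter k i).1⟩,
      ⟨fun i => (abs_le.1 (hiter k i).2.2).2, fun i => (hiter k i).2.1⟩⟩
  obtain ⟨ψ, hψ, hlim⟩ := hp.tendsto_subseq
  have hlimx : Tendsto (fun j => x (ψ j)) atTop (nhds p.1) := (continuous_fst.tendsto p).comp hlim
  have hlimθ : Tendsto (fun j => θ (ψ j)) atTop (nhds p.2) := (continuous_snd.tendsto p).comp hlim
  have hppos : ∀ i, 0 < p.2 i := fun i =>
    ha.trans_le (ge_of_tendsto' (tendsto_pi_nhds.1 hlimθ i) fun j => (hiter (ψ j) i).1)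
  have hlimG : Tendsto (fun j => gibbsG N M F y σ r η vth (x (ψ j), θ (ψ j))) atTop
      (nhds (gibbsG N M F y σ r η vth p)) :=
    (continuousAt_gibbsG F y σ r η hvth hppos).tendsto.comp hlim
  refine ⟨hppos, fun θ' hθ' => ?_, fun x' => ?_⟩
  · have hle : ∀ k, gibbsG N M F y σ r η vth p ≤ gibbsG N M F y σ r η vth (x k, θ k) := fun k =>
      le_of_tendsto hlimG <| (eventually_ge_atTop k).mono fun j hj =>
        hanti (hj.trans (hψ.id_le j))
    have hlim' : Tendsto (fun j => gibbsG N M F y σ r η vth (x (ψ j), θ')) atTop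
        (nhds (gibbsG N M F y σ r η vth (p.1, θ'))) :=
      (continuousAt_gibbsG F y σ r η hvth (p := (p.1, θ')) hθ').tendsto.comp
        (hlimx.prodMk_nhds tendsto_const_nhds)
    exact ge_of_tendsto' hlim' fun j =>
      (hle (ψ j + 1)).trans ((hxmin (ψ j) (x (ψ j))).trans (hθmin (ψ j) θ' hθ'))
  · have hlim' : Tendsto (fun j => gibbsG N M F y σ r η vth (x', θ (ψ j))) atTop
        (nhds (gibbsG N M F y σ r η vth (x', p.2))) :=
      (continuousAt_gibbsG F y σ r η hvth (p := (x', p.2)) hppos).tendsto.comp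
        (tendsto_const_nhds.prodMk_nhds hlimθ)
    refine le_of_tendsto_of_tendsto hlimG hlim' <| (eventually_ge_atTop 1).mono fun j hj => ?_
    obtain ⟨k, hk⟩ := Nat.exists_eq_add_of_le' (hj.trans (hψ.id_le j))
    simp only [hk]
    exact hxmin k x'
end

section
/- Assume either (r > 0 and η = rβ − 3/2 > 0) or (r < 0 and η < −3/2), and set ε = ϑ_min (η/r)^{1/r} > 0. Then for every α ∈ ℝ, the sublevel set {(x, θ) ∈ ℝ^N × ℝ^N : θ_i ≥ ε for all i and G(x, θ) ≤ α} is bounded; moreover G(x, θ) → +∞ as ‖(x, θ)‖ → ∞ with (x, θ) ranging over ℝ^N × [ε, ∞)^N, and G is continuous on ℝ^N × [ε, ∞)^N. -/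
open Real Filter

/-- The scalar function `t ↦ (t/v)^r − η log t` is coercive at `+∞` when `r` and `η` have the
same sign. -/
theorem tendsto_rpow_sub_log_atTop {r η v : ℝ} (hv : 0 < v)
    (hcase : (0 < r ∧ 0 < η) ∨ (r < 0 ∧ η < 0)) :
    Tendsto (fun t : ℝ => (t / v) ^ r - η * log t) atTop atTop := by
  rcases hcase with ⟨hr, hη⟩ | ⟨-, hη⟩
  · have hlim : Tendsto (fun t : ℝ => 1 / 2 * (t / v) ^ r
        + (-(η / r) * log (2 * (η / r)) - η * log v)) atTop atTop :=
      tendsto_atTop_add_const_right _ _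
        (((tendsto_rpow_atTop hr).comp (tendsto_id.atTop_div_const hv)).const_mul_atTop
          (by norm_num))
    refine tendsto_atTop_mono' _ ?_ hlim
    filter_upwards [eventually_gt_atTop 0] with t ht
    have hk : 0 < η / r := div_pos hη hr
    have hu : 0 < (t / v) ^ r := rpow_pos_of_pos (div_pos ht hv) r
    have hlog_u : log ((t / v) ^ r) = r * (log t - log v) := by
      rw [log_rpow (div_pos ht hv), log_div ht.ne' hv.ne']
    have hle := log_le_sub_one_of_pos (div_pos hu (mul_pos two_pos hk))
    rw [log_div hu.ne' (mul_pos two_pos hk).ne', hlog_u] at hle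
    have hmul := mul_le_mul_of_nonneg_left hle hk.le
    have hleft : η / r * (r * (log t - log v) - log (2 * (η / r)))
        = η * (log t - log v) - η / r * log (2 * (η / r)) := by
      field_simp
    have hright : η / r * ((t / v) ^ r / (2 * (η / r)) - 1)
        = 1 / 2 * (t / v) ^ r - η / r := by
      field_simp
    rw [hleft, hright] at hmul
    linarith
  · refine tendsto_atTop_mono' _ ?_ (tendsto_log_atTop.const_mul_atTop (neg_pos.mpr hη))
    filter_upwards [eventually_gt_atTop 0] with t ht
    have := rpow_nonneg (div_pos ht hv).le r
    linarith

/-- A function continuous on `[a, ∞)` and tending to `+∞` is bounded below on `[a, ∞)`. -/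
theorem exists_forall_le_of_tendsto_atTop {f : ℝ → ℝ} {a : ℝ}
    (hf : ContinuousOn f (Set.Ici a)) (hlim : Tendsto f atTop atTop) :
    ∃ m, ∀ t, a ≤ t → m ≤ f t := by
  obtain ⟨T, hT⟩ := eventually_atTop.mp (hlim.eventually_ge_atTop 0)
  obtain ⟨m, hm⟩ := (isCompact_Icc (a := a) (b := T)).bddBelow_image
    (hf.mono Set.Icc_subset_Ici_self)
  refine ⟨min m 0, fun t ht => ?_⟩
  rcases le_total t T with h | h
  · exact (min_le_left _ _).trans (hm ⟨t, ⟨ht, h⟩, rfl⟩)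
  · exact (min_le_right _ _).trans (hT t h)

theorem continuousOn_rpow_sub_log {r η v a : ℝ} (hv : 0 < v) (ha : 0 < a) :
    ContinuousOn (fun t : ℝ => (t / v) ^ r - η * log t) (Set.Ici a) := by
  intro t ht
  have ht0 : 0 < t := ha.trans_le ht
  exact (((continuousAt_id.div_const v).rpow_const (Or.inl (div_pos ht0 hv).ne')).sub
    (continuousAt_const.mul (continuousAt_log ht0.ne'))).continuousWithinAt

/-- Sublevel sets of the Gibbs energy over `ℝ^N × [a, ∞)^N` are bounded. -/
theorem isBounded_sublevel_gibbsG {N M : ℕ} (F : Matrix (Fin M) (Fin N) ℝ) (y : Fin M → ℝ)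
    (σ : ℝ) {r η : ℝ} {vth : Fin N → ℝ} (hvth : ∀ i, 0 < vth i)
    (hcase : (0 < r ∧ 0 < η) ∨ (r < 0 ∧ η < 0)) {a : ℝ} (ha : 0 < a) (α : ℝ) :
    Bornology.IsBounded {p : (Fin N → ℝ) × (Fin N → ℝ) |
      (∀ i, a ≤ p.2 i) ∧ gibbsG N M F y σ r η vth p ≤ α} := by
  have hlim := fun i => tendsto_rpow_sub_log_atTop (hvth i) hcase
  choose m hm using fun i => exists_forall_le_of_tendsto_atTop
    (continuousOn_rpow_sub_log (r := r) (η := η) (hvth i) ha) (hlim i)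
  set A : ℝ := α - ∑ i, m i with hA
  choose T hT using fun i => eventually_atTop.mp ((hlim i).eventually_gt_atTop (m i + A))
  refine (Metric.isBounded_Icc ((fun i => -(2 * A * T i + 1), fun _ => a) :
    (Fin N → ℝ) × (Fin N → ℝ)) (fun i => 2 * A * T i + 1, T)).subset ?_
  rintro ⟨x, θ⟩ ⟨hθ, hG⟩
  simp only [gibbsG] at hθ hG
  have hθ0 : ∀ i, 0 < θ i := fun i => ha.trans_le (hθ i)
  have hfit : 0 ≤ 1 / (2 * σ ^ 2) * ∑ j, (F.mulVec x j - y j) ^ 2 := by positivity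
  have hquad : ∀ i, 0 ≤ x i ^ 2 / θ i := fun i => div_nonneg (sq_nonneg _) (hθ0 i).le
  have hgap : ∀ i, 0 ≤ (θ i / vth i) ^ r - η * log (θ i) - m i :=
    fun i => sub_nonneg.mpr (hm i _ (hθ i))
  have hterm : ∀ i, 0 ≤ 1 / 2 * (x i ^ 2 / θ i)
      + ((θ i / vth i) ^ r - η * log (θ i) - m i) := fun i => by
    linarith [hquad i, hgap i]
  have hsum : ∑ i, (1 / 2 * (x i ^ 2 / θ i)
      + ((θ i / vth i) ^ r - η * log (θ i) - m i)) ≤ A := by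
    simp only [Finset.sum_add_distrib, Finset.sum_sub_distrib, ← Finset.mul_sum]
    linarith
  have hle : ∀ i, 1 / 2 * (x i ^ 2 / θ i)
      + ((θ i / vth i) ^ r - η * log (θ i) - m i) ≤ A := fun i =>
    (Finset.single_le_sum (fun j _ => hterm j) (Finset.mem_univ i)).trans hsum
  have hθT : ∀ i, θ i ≤ T i := fun i => by
    by_contra! h
    linarith [hT i _ h.le, hle i, hquad i]
  have hx : ∀ i, |x i| ≤ 2 * A * T i + 1 := fun i => by
    have hA0 : 0 ≤ A := (hterm i).trans (hle i)
    have hdiv : x i ^ 2 / θ i ≤ 2 * A := by linarith [hle i, hgap i]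
    have hsq : x i ^ 2 ≤ 2 * A * T i :=
      ((div_le_iff₀ (hθ0 i)).mp hdiv).trans
        (mul_le_mul_of_nonneg_left (hθT i) (by linarith))
    nlinarith [sq_abs (x i), sq_nonneg (|x i| - 1)]
  exact ⟨⟨fun i => (abs_le.mp (hx i)).1, hθ⟩, ⟨fun i => (abs_le.mp (hx i)).2, hθT⟩⟩

/-- The Gibbs energy is continuous on `ℝ^N × [a, ∞)^N`. -/
theorem continuousOn_gibbsG {N M : ℕ} (F : Matrix (Fin M) (Fin N) ℝ) (y : Fin M → ℝ)
    (σ r η : ℝ) {vth : Fin N → ℝ} (hvth : ∀ i, 0 < vth i) {a : ℝ} (ha : 0 < a) :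
    ContinuousOn (gibbsG N M F y σ r η vth)
      {p : (Fin N → ℝ) × (Fin N → ℝ) | ∀ i, a ≤ p.2 i} := by
  have hpos : ∀ i, ∀ p ∈ {p : (Fin N → ℝ) × (Fin N → ℝ) | ∀ i, a ≤ p.2 i}, 0 < p.2 i :=
    fun i p hp => ha.trans_le (hp i)
  have hθ : ∀ i, Continuous fun p : (Fin N → ℝ) × (Fin N → ℝ) => p.2 i := fun i => by fun_prop
  have hfit : Continuous fun p : (Fin N → ℝ) × (Fin N → ℝ) =>
      (1 / (2 * σ ^ 2)) * ∑ j, (F.mulVec p.1 j - y j) ^ 2 := by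
    simp only [Matrix.mulVec, dotProduct]
    fun_prop
  refine ((hfit.continuousOn.add (continuousOn_const.mul (continuousOn_finsetSum _ fun i _ =>
    ContinuousOn.div (by fun_prop) (hθ i).continuousOn fun p hp => (hpos i p hp).ne'))).add
    (continuousOn_finsetSum _ fun i _ => ?_)).sub
    (continuousOn_const.mul (continuousOn_finsetSum _ fun i _ => ?_))
  · exact ((hθ i).continuousOn.div_const _).rpow_const fun p hp =>
      Or.inl (div_pos (hpos i p hp) (hvth i)).ne'
  · exact (hθ i).continuousOn.log fun p hp => (hpos i p hp).ne'

/-- With `ε = ϑ_min (η/r)^{1/r} > 0`: every sublevel set of `G` restricted to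
`ℝ^N × [ε, ∞)^N` is bounded, `G → +∞` as `‖(x, θ)‖ → ∞` on that region, and `G` is
continuous on that region. -/
theorem statement5 (N M : ℕ) (hN : 0 < N) (hM : 0 < M)
    (F : Matrix (Fin M) (Fin N) ℝ) (y : Fin M → ℝ)
    (σ : ℝ) (hσ : 0 < σ)
    (r β η : ℝ) (hr0 : r ≠ 0) (hβ : 0 < β) (hη_def : η = r * β - 3 / 2)
    (vth : Fin N → ℝ) (hvth : ∀ i, 0 < vth i)
    (hcase : (0 < r ∧ 0 < η) ∨ (r < 0 ∧ η < -(3 / 2))) :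
    letI eps : ℝ :=
      (Finset.univ.inf' (Finset.univ_nonempty_iff.mpr (Fin.pos_iff_nonempty.mp hN)) vth)
        * (η / r) ^ (1 / r)
    (0 < eps) ∧
    (∀ α : ℝ, Bornology.IsBounded
      {p : (Fin N → ℝ) × (Fin N → ℝ) |
        (∀ i, eps ≤ p.2 i) ∧ gibbsG N M F y σ r η vth p ≤ α}) ∧
    (∀ C : ℝ, ∃ ρ : ℝ, ∀ p : (Fin N → ℝ) × (Fin N → ℝ),
      (∀ i, eps ≤ p.2 i) → ρ ≤ ‖p‖ → C ≤ gibbsG N M F y σ r η vth p) ∧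
    ContinuousOn (gibbsG N M F y σ r η vth)
      {p : (Fin N → ℝ) × (Fin N → ℝ) | ∀ i, eps ≤ p.2 i} := by
  set eps : ℝ :=
    (Finset.univ.inf' (Finset.univ_nonempty_iff.mpr (Fin.pos_iff_nonempty.mp hN)) vth)
      * (η / r) ^ (1 / r)
  have hcase' : (0 < r ∧ 0 < η) ∨ (r < 0 ∧ η < 0) :=
    hcase.imp_right fun h => ⟨h.1, by linarith [h.2]⟩
  have hratio : 0 < η / r := by
    rcases hcase' with ⟨hr, hη⟩ | ⟨hr, hη⟩
    · exact div_pos hη hr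
    · exact div_pos_of_neg_of_neg hη hr
  have heps : 0 < eps :=
    mul_pos ((Finset.lt_inf'_iff _).mpr fun i _ => hvth i) (rpow_pos_of_pos hratio _)
  have hbdd := isBounded_sublevel_gibbsG F y σ hvth hcase' heps
  refine ⟨heps, hbdd, fun C => ?_, continuousOn_gibbsG F y σ r η hvth heps⟩
  obtain ⟨R, hR⟩ := (hbdd C).exists_norm_le
  refine ⟨R + 1, fun p hp hnorm => ?_⟩
  by_contra! h
  linarith [hR p ⟨hp, h.le⟩]
end

section
/- Assume the common kernel condition ker(F) ∩ ker(R) = {0}. If r ≥ 1, r̃ ≥ 1, η = rβ − 3/2 > 0 and η̃ = r̃β̃ − (M+2)/2 > 0, then the generalized Gibbs energy functional G(x, θ, ν) = (1/(2ν))‖Fx − y‖₂² + (1/2)∑_{i=1}^K ([Rx]_i)²/θ_i + (ν/ϑ̃)^{r̃} + ∑_{i=1}^K (θ_i/ϑ_i)^r − η̃ log ν − η ∑_{i=1}^K log θ_i is strictly convex on ℝ^N × ℝ_{++}^K × ℝ_{++}. -/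
open Real Filter

/-- The generalized Gibbs energy functional
`G(x, θ, ν) = (1/(2ν))‖Fx − y‖₂² + (1/2)∑ᵢ ([Rx]ᵢ)²/θᵢ + (ν/ϑ̃)^r̃ + ∑ᵢ (θᵢ/ϑᵢ)^r
  − η̃ log ν − η ∑ᵢ log θᵢ`. -/
noncomputable def ggibbs (N M K : ℕ) (F : Matrix (Fin M) (Fin N) ℝ)
    (R : Matrix (Fin K) (Fin N) ℝ) (y : Fin M → ℝ)
    (r η rt ηt vtht : ℝ) (vth : Fin K → ℝ) :
    (Fin N → ℝ) × (Fin K → ℝ) × ℝ → ℝ :=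
  fun p =>
    (1 / (2 * p.2.2)) * ∑ j, (F.mulVec p.1 j - y j) ^ 2
      + (1 / 2) * ∑ i, (R.mulVec p.1 i) ^ 2 / p.2.1 i
      + (p.2.2 / vtht) ^ rt
      + ∑ i, (p.2.1 i / vth i) ^ r
      - ηt * Real.log p.2.2
      - η * ∑ i, Real.log (p.2.1 i)

/-- The perspective `u ^ 2 / t` of the square is strictly convex along segments that do not lie on
a ray through the origin. -/
theorem sq_div_lt_of_mul_ne {a b t₁ t₂ u₁ u₂ : ℝ} (ha : 0 < a) (hb : 0 < b) (ht₁ : 0 < t₁)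
    (ht₂ : 0 < t₂) (h : u₁ * t₂ ≠ u₂ * t₁) :
    (a * u₁ + b * u₂) ^ 2 / (a * t₁ + b * t₂) < a * (u₁ ^ 2 / t₁) + b * (u₂ ^ 2 / t₂) := by
  have hpos : 0 < a * t₁ + b * t₂ := by positivity
  have hsq : 0 < (u₁ * t₂ - u₂ * t₁) ^ 2 := by
    have := sub_ne_zero.mpr h
    positivity
  have key : a * (u₁ ^ 2 / t₁) + b * (u₂ ^ 2 / t₂) =
      ((a * u₁ ^ 2 * t₂ + b * u₂ ^ 2 * t₁) * (a * t₁ + b * t₂)) /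
        (t₁ * t₂ * (a * t₁ + b * t₂)) := by
    field_simp
  have key' : (a * u₁ + b * u₂) ^ 2 / (a * t₁ + b * t₂) =
      ((a * u₁ + b * u₂) ^ 2 * (t₁ * t₂)) / (t₁ * t₂ * (a * t₁ + b * t₂)) := by
    field_simp
  rw [key, key']
  apply div_lt_div_of_pos_right _ (by positivity)
  have : 0 < a * b * (u₁ * t₂ - u₂ * t₁) ^ 2 := by positivity
  linear_combination this

/-- The perspective `u ^ 2 / t` of the square is jointly convex for `t > 0`. -/
theorem sq_div_le {a b t₁ t₂ : ℝ} (u₁ u₂ : ℝ) (ha : 0 < a) (hb : 0 < b) (ht₁ : 0 < t₁)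
    (ht₂ : 0 < t₂) :
    (a * u₁ + b * u₂) ^ 2 / (a * t₁ + b * t₂) ≤ a * (u₁ ^ 2 / t₁) + b * (u₂ ^ 2 / t₂) := by
  by_cases h : u₁ * t₂ = u₂ * t₁
  · have hpos : 0 < a * t₁ + b * t₂ := by positivity
    obtain rfl : u₁ = u₂ * t₁ / t₂ := by field_simp; exact h
    apply le_of_eq
    field_simp
  · exact (sq_div_lt_of_mul_ne ha hb ht₁ ht₂ h).le

theorem strictConvexOn_div_rpow_sub_mul_log {v r η : ℝ} (hv : 0 < v) (hr : 1 ≤ r) (hη : 0 < η) :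
    StrictConvexOn ℝ (Set.Ioi 0) fun t : ℝ => (t / v) ^ r - η * Real.log t := by
  refine ⟨convex_Ioi 0, fun s hs t ht hst a b ha hb hab => ?_⟩
  have hs' : (0 : ℝ) < s := hs
  have ht' : (0 : ℝ) < t := ht
  have hpow := (convexOn_rpow hr).2 (x := s / v) (y := t / v) (div_nonneg hs'.le hv.le)
    (div_nonneg ht'.le hv.le) ha.le hb.le hab
  have hlog := mul_lt_mul_of_pos_left (strictConcaveOn_log_Ioi.2 hs ht hst ha hb hab) hη
  simp only [smul_eq_mul] at hpow hlog ⊢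
  rw [show (a * s + b * t) / v = a * (s / v) + b * (t / v) by ring]
  linarith

/-- The Gibbs energy is a sum of perspectives of the square and of strictly convex functions of
the individual variances. -/
theorem ggibbs_eq_sum (N M K : ℕ) (F : Matrix (Fin M) (Fin N) ℝ)
    (R : Matrix (Fin K) (Fin N) ℝ) (y : Fin M → ℝ) (r η rt ηt vtht : ℝ) (vth : Fin K → ℝ)
    (p : (Fin N → ℝ) × (Fin K → ℝ) × ℝ) :
    ggibbs N M K F R y r η rt ηt vtht vth p =
      (1 / 2) * ∑ j, (F.mulVec p.1 j - y j) ^ 2 / p.2.2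
        + (1 / 2) * ∑ i, (R.mulVec p.1 i) ^ 2 / p.2.1 i
        + ((p.2.2 / vtht) ^ rt - ηt * Real.log p.2.2)
        + ∑ i, ((p.2.1 i / vth i) ^ r - η * Real.log (p.2.1 i)) := by
  rw [ggibbs, Finset.sum_sub_distrib, ← Finset.mul_sum, ← Finset.sum_div]
  ring

/-- Under the common kernel condition `ker F ∩ ker R = {0}`, if `r, r̃ ≥ 1`,
`η = rβ − 3/2 > 0` and `η̃ = r̃β̃ − (M+2)/2 > 0`, the generalized Gibbs energy
functional is strictly convex on `ℝ^N × ℝ_{++}^K × ℝ_{++}`. -/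
theorem statement6 (N M K : ℕ) (hN : 0 < N) (hM : 0 < M) (hK : 0 < K)
    (F : Matrix (Fin M) (Fin N) ℝ) (R : Matrix (Fin K) (Fin N) ℝ) (y : Fin M → ℝ)
    (hker : LinearMap.ker F.mulVecLin ⊓ LinearMap.ker R.mulVecLin = ⊥)
    (r β η : ℝ) (hr0 : r ≠ 0) (hβ : 0 < β) (hη_def : η = r * β - 3 / 2)
    (vth : Fin K → ℝ) (hvth : ∀ i, 0 < vth i)
    (rt βt ηt vtht : ℝ) (hrt0 : rt ≠ 0) (hβt : 0 < βt)
    (hηt_def : ηt = rt * βt - (M + 2 : ℝ) / 2) (hvtht : 0 < vtht)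
    (hr : 1 ≤ r) (hrt : 1 ≤ rt) (hη : 0 < η) (hηt : 0 < ηt) :
    StrictConvexOn ℝ
      {p : (Fin N → ℝ) × (Fin K → ℝ) × ℝ | (∀ i, 0 < p.2.1 i) ∧ 0 < p.2.2}
      (ggibbs N M K F R y r η rt ηt vtht vth) := by
  constructor
  · rintro p ⟨hp, hp'⟩ q ⟨hq, hq'⟩ a b ha hb hab
    exact ⟨fun i => convex_Ioi (0 : ℝ) (hp i) (hq i) ha hb hab,
      convex_Ioi (0 : ℝ) hp' hq' ha hb hab⟩
  rintro ⟨x₁, θ₁, ν₁⟩ ⟨hθ₁, hν₁⟩ ⟨x₂, θ₂, ν₂⟩ ⟨hθ₂, hν₂⟩ hne a b ha hb hab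
  dsimp only at hθ₁ hν₁ hθ₂ hν₂
  simp only [ggibbs_eq_sum, Prod.smul_mk, Prod.mk_add_mk, smul_eq_mul, Pi.add_apply,
    Pi.smul_apply, Matrix.mulVec_add, Matrix.mulVec_smul]
  have hres : ∀ j, a * F.mulVec x₁ j + b * F.mulVec x₂ j - y j =
      a * (F.mulVec x₁ j - y j) + b * (F.mulVec x₂ j - y j) := fun j => by
    linear_combination y j * hab
  simp only [hres]
  have hF := fun j => sq_div_le (F.mulVec x₁ j - y j) (F.mulVec x₂ j - y j) ha hb hν₁ hν₂
  have hR := fun i => sq_div_le (R.mulVec x₁ i) (R.mulVec x₂ i) ha hb (hθ₁ i) (hθ₂ i)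
  have hconv_ν := strictConvexOn_div_rpow_sub_mul_log hvtht hrt hηt
  have hconv_θ := fun i => strictConvexOn_div_rpow_sub_mul_log (hvth i) hr hη
  have hν := hconv_ν.convexOn.2 hν₁ hν₂ ha.le hb.le hab
  have hθ := fun i => (hconv_θ i).convexOn.2 (hθ₁ i) (hθ₂ i) ha.le hb.le hab
  simp only [smul_eq_mul] at hν hθ
  have sumF := Finset.sum_le_sum fun j (_ : j ∈ Finset.univ) => hF j
  have sumR := Finset.sum_le_sum fun i (_ : i ∈ Finset.univ) => hR i
  have sumθ := Finset.sum_le_sum fun i (_ : i ∈ Finset.univ) => hθ i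
  simp only [Finset.sum_add_distrib, ← Finset.mul_sum] at sumF sumR sumθ
  by_cases hνν : ν₁ = ν₂
  swap
  · have hlt := hconv_ν.2 hν₁ hν₂ hνν ha hb hab
    simp only [smul_eq_mul] at hlt
    linarith
  by_cases hθθ : θ₁ = θ₂
  swap
  · obtain ⟨i, hi⟩ := Function.ne_iff.mp hθθ
    have hlt := (hconv_θ i).2 (hθ₁ i) (hθ₂ i) hi ha hb hab
    simp only [smul_eq_mul] at hlt
    have hsum := Finset.sum_lt_sum (fun i _ => hθ i) ⟨i, Finset.mem_univ i, hlt⟩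
    simp only [Finset.sum_add_distrib, ← Finset.mul_sum] at hsum
    linarith
  subst hνν hθθ
  have hx : x₁ - x₂ ≠ 0 := fun h => hne (by rw [sub_eq_zero.mp h])
  by_cases hFx : F.mulVec x₁ = F.mulVec x₂
  · have hRx : R.mulVec x₁ ≠ R.mulVec x₂ := fun hRx => hx <| by
      rw [← Submodule.mem_bot ℝ, ← hker]
      simp [Matrix.mulVec_sub, hFx, hRx]
    obtain ⟨i, hi⟩ := Function.ne_iff.mp hRx
    have hlt := sq_div_lt_of_mul_ne ha hb (hθ₁ i) (hθ₁ i)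
      (fun h => hi (mul_right_cancel₀ (hθ₁ i).ne' h))
    have hsum := Finset.sum_lt_sum (fun i _ => hR i) ⟨i, Finset.mem_univ i, hlt⟩
    simp only [Finset.sum_add_distrib, ← Finset.mul_sum] at hsum
    linarith
  · obtain ⟨j, hj⟩ := Function.ne_iff.mp hFx
    have hlt := sq_div_lt_of_mul_ne (u₁ := F.mulVec x₁ j - y j) (u₂ := F.mulVec x₂ j - y j)
      ha hb hν₁ hν₁ (fun h => hj (sub_left_injective (mul_right_cancel₀ hν₁.ne' h)))
    have hsum := Finset.sum_lt_sum (fun j _ => hF j) ⟨j, Finset.mem_univ j, hlt⟩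
    simp only [Finset.sum_add_distrib, ← Finset.mul_sum] at hsum
    linarith
end

section
/- Assume the common kernel condition ker(F) ∩ ker(R) = {0}, r ≥ 1, r̃ ≥ 1, η = rβ − 3/2 > 0 and η̃ = r̃β̃ − (M+2)/2 > 0. Then the generalized Gibbs energy functional G attains a unique global minimizer (x*, θ*, ν*) over ℝ^N × ℝ_{++}^K × ℝ_{++}, and any sequence (x^{(k)}, θ^{(k)}, ν^{(k)}) satisfying the exact block-coordinate minimization conditions — for every k: θ^{(k+1)} minimizes θ ↦ G(x^{(k)}, θ, ν^{(k)}), ν^{(k+1)} minimizes ν ↦ G(x^{(k)}, θ^{(k+1)}, ν), and x^{(k+1)} minimizes x ↦ G(x, θ^{(k+1)}, ν^{(k+1)}) — converges to (x*, θ*, ν*) as k → ∞. -/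
open Real Filter

open Set Topology

section BlockDescent

variable {E₁ E₂ E₃ : Type*}
  [NormedAddCommGroup E₁] [NormedSpace ℝ E₁]
  [NormedAddCommGroup E₂] [NormedSpace ℝ E₂]
  [NormedAddCommGroup E₃] [NormedSpace ℝ E₃]

/-- A critical point of a convex function is a global minimizer. -/
theorem ConvexOn.le_of_hasFDerivAt_zero {E : Type*} [NormedAddCommGroup E] [NormedSpace ℝ E]
    {D : Set E} {f : E → ℝ} (hf : ConvexOn ℝ D f) {p q : E} (hp : p ∈ D) (hq : q ∈ D)
    (h : HasFDerivAt f (0 : E →L[ℝ] ℝ) p) : f p ≤ f q := by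
  have hline : HasDerivAt (fun t : ℝ => f (AffineMap.lineMap p q t)) 0 0 := by
    have h1 : HasDerivAt (fun t : ℝ => AffineMap.lineMap p q t) (q - p) 0 :=
      AffineMap.hasDerivAt_lineMap
    have h2 : HasFDerivAt f (0 : E →L[ℝ] ℝ) (AffineMap.lineMap p q (0 : ℝ)) := by simpa using h
    simpa [Function.comp_def] using h2.comp_hasDerivAt (0 : ℝ) h1
  have hconv := hf.comp_affineMap (AffineMap.lineMap p q : ℝ →ᵃ[ℝ] E)
  have := hconv.le_slope_of_hasDerivWithinAt (x := 0) (y := 1) (by simpa using hp)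
    (by simpa using hq) one_pos hline.hasDerivWithinAt
  simpa [slope_def_field] using this

/-- A point that minimizes a differentiable convex function along each of three blocks of
variables is a global minimizer. -/
theorem ConvexOn.le_of_blockwise_le {A : Set E₁} {B : Set E₂} {C : Set E₃}
    (hA : IsOpen A) (hB : IsOpen B) (hC : IsOpen C) {f : E₁ × E₂ × E₃ → ℝ}
    (hf : ConvexOn ℝ (A ×ˢ B ×ˢ C) f) {a : E₁} {b : E₂} {c : E₃}
    (ha : a ∈ A) (hb : b ∈ B) (hc : c ∈ C) (hd : DifferentiableAt ℝ f (a, b, c))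
    (h₁ : ∀ a' ∈ A, f (a, b, c) ≤ f (a', b, c))
    (h₂ : ∀ b' ∈ B, f (a, b, c) ≤ f (a, b', c))
    (h₃ : ∀ c' ∈ C, f (a, b, c) ≤ f (a, b, c'))
    {q : E₁ × E₂ × E₃} (hq : q ∈ A ×ˢ B ×ˢ C) : f (a, b, c) ≤ f q := by
  refine hf.le_of_hasFDerivAt_zero ⟨ha, hb, hc⟩ hq ?_
  have hL := hd.hasFDerivAt
  set L := fderiv ℝ f (a, b, c)
  have e₁ : L.comp (ContinuousLinearMap.inl ℝ E₁ (E₂ × E₃)) = 0 := by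
    refine IsLocalMin.hasFDerivAt_eq_zero (f := fun a' => f (a', b, c)) (a := a) ?_ ?_
    · filter_upwards [hA.mem_nhds ha] with a' ha' using h₁ a' ha'
    · exact HasFDerivAt.comp a hL (hasFDerivAt_prodMk_left a (b, c))
  have e₂ : L.comp ((ContinuousLinearMap.inr ℝ E₁ (E₂ × E₃)).comp
      (ContinuousLinearMap.inl ℝ E₂ E₃)) = 0 := by
    refine IsLocalMin.hasFDerivAt_eq_zero (f := fun b' => f (a, b', c)) (a := b) ?_ ?_
    · filter_upwards [hB.mem_nhds hb] with b' hb' using h₂ b' hb'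
    · exact HasFDerivAt.comp b hL
        (HasFDerivAt.comp b (hasFDerivAt_prodMk_right a (b, c)) (hasFDerivAt_prodMk_left b c))
  have e₃ : L.comp ((ContinuousLinearMap.inr ℝ E₁ (E₂ × E₃)).comp
      (ContinuousLinearMap.inr ℝ E₂ E₃)) = 0 := by
    refine IsLocalMin.hasFDerivAt_eq_zero (f := fun c' => f (a, b, c')) (a := c) ?_ ?_
    · filter_upwards [hC.mem_nhds hc] with c' hc' using h₃ c' hc'
    · exact HasFDerivAt.comp c hL
        (HasFDerivAt.comp c (hasFDerivAt_prodMk_right a (b, c)) (hasFDerivAt_prodMk_right b c))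
  have hL0 : L = 0 := by
    ext v
    · simpa using DFunLike.congr_fun e₁ v
    · simpa using DFunLike.congr_fun e₂ v
    · simpa using DFunLike.congr_fun e₃ v
  rwa [hL0] at hL

/-- Two points with the same value of a strictly convex function coincide if that value is at
most the value at their midpoint. -/
theorem StrictConvexOn.eq_of_le_midpoint {E : Type*} [AddCommGroup E] [Module ℝ E]
    {D : Set E} {f : E → ℝ} (hf : StrictConvexOn ℝ D f) {p q : E} (hp : p ∈ D) (hq : q ∈ D)
    (hpq : f p = f q) (hm : f q ≤ f ((1 / 2 : ℝ) • p + (1 / 2 : ℝ) • q)) : p = q := by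
  by_contra hne
  have := hf.2 hp hq hne (by norm_num : (0 : ℝ) < 1 / 2) (by norm_num : (0 : ℝ) < 1 / 2)
    (by norm_num)
  simp only [smul_eq_mul] at this
  linarith

/-- Cyclic exact minimization over three blocks converges to the global minimizer of a
differentiable strictly convex function with compact sublevel sets. -/
theorem StrictConvexOn.tendsto_of_block_descent {A : Set E₁} {B : Set E₂} {C : Set E₃}
    (hA : IsOpen A) (hB : IsOpen B) (hC : IsOpen C) {f : E₁ × E₂ × E₃ → ℝ}
    (hf : StrictConvexOn ℝ (A ×ˢ B ×ˢ C) f)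
    (hd : ∀ z ∈ A ×ˢ B ×ˢ C, DifferentiableAt ℝ f z)
    (hcpt : ∀ M : ℝ, IsCompact {z ∈ A ×ˢ B ×ˢ C | f z ≤ M})
    {p : E₁ × E₂ × E₃} (hp : p ∈ A ×ˢ B ×ˢ C) (hmin : ∀ q ∈ A ×ˢ B ×ˢ C, f p ≤ f q)
    {a : ℕ → E₁} {b : ℕ → E₂} {c : ℕ → E₃}
    (ha : ∀ k, a k ∈ A) (hb : ∀ k, b k ∈ B) (hc : ∀ k, c k ∈ C)
    (hstep₂ : ∀ k, ∀ b' ∈ B, f (a k, b (k + 1), c k) ≤ f (a k, b', c k))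
    (hstep₃ : ∀ k, ∀ c' ∈ C, f (a k, b (k + 1), c (k + 1)) ≤ f (a k, b (k + 1), c'))
    (hstep₁ : ∀ k, ∀ a' ∈ A,
      f (a (k + 1), b (k + 1), c (k + 1)) ≤ f (a', b (k + 1), c (k + 1))) :
    Tendsto (fun k => (a k, b k, c k)) atTop (𝓝 p) := by
  have hcontf : ∀ {x y z}, x ∈ A → y ∈ B → z ∈ C → ContinuousAt f (x, y, z) :=
    fun hx hy hz => (hd _ ⟨hx, hy, hz⟩).continuousAt
  set z : ℕ → E₁ × E₂ × E₃ := fun k => (a k, b k, c k)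
  have hanti : Antitone fun k => f (z k) := antitone_nat_of_succ_le fun k =>
    (hstep₁ k _ (ha k)).trans ((hstep₃ k _ (hc k)).trans (hstep₂ k _ (hb k)))
  obtain ⟨l, hl⟩ : ∃ l, Tendsto (fun k => f (z k)) atTop (𝓝 l) :=
    ⟨_, tendsto_atTop_ciInf hanti
      ⟨f p, by rintro _ ⟨k, rfl⟩; exact hmin _ ⟨ha k, hb k, hc k⟩⟩⟩
  have hmem : ∀ k, z k ∈ {w ∈ A ×ˢ B ×ˢ C | f w ≤ f (z 0)} :=
    fun k => ⟨⟨ha k, hb k, hc k⟩, hanti (Nat.zero_le k)⟩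
  refine (hcpt (f (z 0))).tendsto_nhds_of_unique_mapClusterPt (.of_forall hmem) ?_
  rintro ⟨u, v, w⟩ ⟨⟨hu, hv, hw⟩, -⟩ hclu
  obtain ⟨φ, hφ, hφlim⟩ := hclu.tendsto_subseq
  obtain ⟨⟨u', v', w'⟩, ⟨⟨hu', hv', hw'⟩, -⟩, ψ, hψ, hψlim⟩ :=
    (hcpt (f (z 0))).tendsto_subseq fun k => hmem (φ k + 1)
  dsimp only at hu hv hw hu' hv' hw'
  set χ : ℕ → ℕ := φ ∘ ψ
  have hχ : Tendsto χ atTop atTop := (hφ.comp hψ).tendsto_atTop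
  have hlim : Tendsto (fun k => z (χ k)) atTop (𝓝 (u, v, w)) := hφlim.comp hψ.tendsto_atTop
  have hlim' : Tendsto (fun k => z (χ k + 1)) atTop (𝓝 (u', v', w')) := hψlim
  have ta : Tendsto (fun k => a (χ k)) atTop (𝓝 u) := hlim.fst_nhds
  have tb : Tendsto (fun k => b (χ k)) atTop (𝓝 v) := hlim.snd_nhds.fst_nhds
  have tc : Tendsto (fun k => c (χ k)) atTop (𝓝 w) := hlim.snd_nhds.snd_nhds
  have ta' : Tendsto (fun k => a (χ k + 1)) atTop (𝓝 u') := hlim'.fst_nhds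
  have tb' : Tendsto (fun k => b (χ k + 1)) atTop (𝓝 v') := hlim'.snd_nhds.fst_nhds
  have tc' : Tendsto (fun k => c (χ k + 1)) atTop (𝓝 w') := hlim'.snd_nhds.snd_nhds
  have tf : ∀ {x : ℕ → E₁} {y : ℕ → E₂} {t : ℕ → E₃} {x₀ y₀ t₀}, x₀ ∈ A → y₀ ∈ B → t₀ ∈ C →
      Tendsto x atTop (𝓝 x₀) → Tendsto y atTop (𝓝 y₀) → Tendsto t atTop (𝓝 t₀) →
      Tendsto (fun k => f (x k, y k, t k)) atTop (𝓝 (f (x₀, y₀, t₀))) :=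
    fun hx hy ht h₁ h₂ h₃ =>
      (hcontf hx hy ht).tendsto.comp (h₁.prodMk_nhds (h₂.prodMk_nhds h₃))
  have hval : f (u, v, w) = l :=
    tendsto_nhds_unique (tf hu hv hw ta tb tc) (hl.comp hχ)
  have hval' : f (u', v', w') = l :=
    tendsto_nhds_unique (tf hu' hv' hw' ta' tb' tc')
      (hl.comp ((tendsto_add_atTop_nat 1).comp hχ))
  have min₂ : ∀ y ∈ B, f (u, v', w) ≤ f (u, y, w) := fun y hy =>
    le_of_tendsto_of_tendsto' (tf hu hv' hw ta tb' tc) (tf hu hy hw ta tendsto_const_nhds tc)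
      fun k => hstep₂ (χ k) y hy
  have min₃ : ∀ t ∈ C, f (u, v', w') ≤ f (u, v', t) := fun t ht =>
    le_of_tendsto_of_tendsto' (tf hu hv' hw' ta tb' tc') (tf hu hv' ht ta tb' tendsto_const_nhds)
      fun k => hstep₃ (χ k) t ht
  have min₁ : ∀ x ∈ A, f (u', v', w') ≤ f (x, v', w') := fun x hx =>
    le_of_tendsto_of_tendsto' (tf hu' hv' hw' ta' tb' tc')
      (tf hx hv' hw' tendsto_const_nhds tb' tc') fun k => hstep₁ (χ k) x hx
  have i₁ := min₁ u hu
  have i₂ := min₂ v hv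
  have i₃ := min₃ w hw
  have hconv := hf.1
  have hmid₂ := hconv (x := (u, v', w)) ⟨hu, hv', hw⟩ (y := (u, v, w)) ⟨hu, hv, hw⟩
    (by norm_num : (0 : ℝ) ≤ 1 / 2) (by norm_num : (0 : ℝ) ≤ 1 / 2) (by norm_num)
  have hvv : v' = v := by
    have := hf.eq_of_le_midpoint (p := (u, v', w)) (q := (u, v, w)) ⟨hu, hv', hw⟩ ⟨hu, hv, hw⟩
      (by linarith) (by
        have := min₂ _ hmid₂.2.1
        simp only [Prod.smul_mk, Prod.mk_add_mk,
          Convex.combo_self (add_halves (1 : ℝ))] at this ⊢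
        linarith)
    simpa using this
  subst hvv
  have hmid₃ := hconv (x := (u, v', w')) ⟨hu, hv', hw'⟩ (y := (u, v', w)) ⟨hu, hv', hw⟩
    (by norm_num : (0 : ℝ) ≤ 1 / 2) (by norm_num : (0 : ℝ) ≤ 1 / 2) (by norm_num)
  have hww : w' = w := by
    have := hf.eq_of_le_midpoint (p := (u, v', w')) (q := (u, v', w)) ⟨hu, hv', hw'⟩
      ⟨hu, hv', hw⟩ (by linarith) (by
        have := min₃ _ hmid₃.2.2
        simp only [Prod.smul_mk, Prod.mk_add_mk,
          Convex.combo_self (add_halves (1 : ℝ))] at this ⊢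
        linarith)
    simpa using this
  subst hww
  have min₁' : ∀ x ∈ A, f (u, v', w') ≤ f (x, v', w') := fun x hx => by
    have := min₁ x hx
    linarith
  have hglob : f (u, v', w') ≤ f p :=
    hf.convexOn.le_of_blockwise_le hA hB hC hu hv' hw' (hd _ ⟨hu, hv', hw'⟩) min₁' min₂ min₃ hp
  refine hf.eq_of_le_midpoint ⟨hu, hv', hw'⟩ hp (hglob.antisymm (hmin _ ⟨hu, hv', hw'⟩)) ?_
  exact hmin _ (hconv ⟨hu, hv', hw'⟩ hp (by norm_num) (by norm_num) (by norm_num))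

end BlockDescent

section OneDimensional

/-- The potential `t ↦ (t / s) ^ r - η log t` of a single positive hyperparameter. -/
noncomputable def hyperPotential (r η s t : ℝ) : ℝ := (t / s) ^ r - η * Real.log t

theorem strictConvexOn_hyperPotential {r η s : ℝ} (hr : 1 ≤ r) (hη : 0 < η) (hs : 0 < s) :
    StrictConvexOn ℝ (Ioi 0) (hyperPotential r η s) := by
  refine ⟨convex_Ioi 0, fun a ha b hb hab p q hp hq hpq => ?_⟩
  have h1 := (convexOn_rpow hr).2 (x := a / s) (y := b / s) (div_pos ha hs).le (div_pos hb hs).le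
    hp.le hq.le hpq
  have h2 := strictConcaveOn_log_Ioi.2 ha hb hab hp hq hpq
  have h3 : (p * a + q * b) / s = p * (a / s) + q * (b / s) := by ring
  simp only [smul_eq_mul, hyperPotential, h3] at *
  nlinarith [mul_lt_mul_of_pos_left h2 hη]

theorem exists_add_le_hyperPotential {r η s : ℝ} (hr : 1 ≤ r) (hη : 0 < η) (hs : 0 < s) :
    ∃ m, ∀ t, 0 < t → t / (2 * s) + m ≤ hyperPotential r η s t := by
  refine ⟨-1 + η - η * Real.log (2 * η * s), fun t ht => ?_⟩
  have hts : 0 < t / s := div_pos ht hs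
  have h1 : t / s - 1 ≤ (t / s) ^ r := by
    rcases le_total 1 (t / s) with h | h
    · linarith [Real.self_le_rpow_of_one_le h hr]
    · linarith [Real.rpow_nonneg hts.le r]
  have hc : 0 < 2 * η * s := by positivity
  have h2 := Real.log_le_sub_one_of_pos (div_pos ht hc)
  rw [Real.log_div ht.ne' hc.ne'] at h2
  have h3 : η * (t / (2 * η * s)) = t / (2 * s) := by field_simp
  have h4 : t / s = t / (2 * s) + t / (2 * s) := by field_simp; ring
  have h5 := mul_le_mul_of_nonneg_left h2 hη.le
  unfold hyperPotential
  nlinarith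

theorem exists_le_hyperPotential {r η s : ℝ} (hr : 1 ≤ r) (hη : 0 < η) (hs : 0 < s) :
    ∃ m, ∀ t, 0 < t → m ≤ hyperPotential r η s t := by
  obtain ⟨m, hm⟩ := exists_add_le_hyperPotential hr hη hs
  refine ⟨m, fun t ht => ?_⟩
  have : 0 < t / (2 * s) := by positivity
  linarith [hm t ht]

theorem exists_Icc_of_hyperPotential_le {r η s : ℝ} (hr : 1 ≤ r) (hη : 0 < η) (hs : 0 < s)
    (c : ℝ) : ∃ a b, 0 < a ∧ ∀ t, 0 < t → hyperPotential r η s t ≤ c → t ∈ Icc a b := by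
  obtain ⟨m, hm⟩ := exists_add_le_hyperPotential hr hη hs
  refine ⟨Real.exp (-c / η), 2 * s * (c - m), Real.exp_pos _, fun t ht htc => ⟨?_, ?_⟩⟩
  · rw [← Real.le_log_iff_exp_le ht, div_le_iff₀ hη]
    have : 0 ≤ (t / s) ^ r := Real.rpow_nonneg (div_pos ht hs).le r
    unfold hyperPotential at htc
    linarith
  · have : t / (2 * s) ≤ c - m := by linarith [hm t ht]
    rw [div_le_iff₀ (by positivity)] at this
    linarith

theorem sq_div_combo_defect {a b s t : ℝ} (ha : 0 < a) (hb : 0 < b) (hs : 0 < s) (ht : 0 < t)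
    (u v : ℝ) : s * (u ^ 2 / a) + t * (v ^ 2 / b) - (s * u + t * v) ^ 2 / (s * a + t * b)
      = s * t * (u * b - v * a) ^ 2 / (a * b * (s * a + t * b)) := by
  have : s * a + t * b ≠ 0 := by positivity
  field_simp
  ring

/-- Joint convexity of `(u, a) ↦ u² / a` for `a > 0`. -/
theorem sq_div_combo_le {a b s t : ℝ} (ha : 0 < a) (hb : 0 < b) (hs : 0 < s) (ht : 0 < t)
    (u v : ℝ) :
    (s * u + t * v) ^ 2 / (s * a + t * b) ≤ s * (u ^ 2 / a) + t * (v ^ 2 / b) := by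
  rw [← sub_nonneg, sq_div_combo_defect ha hb hs ht]
  positivity

theorem sq_div_combo_lt {a s t : ℝ} (ha : 0 < a) (hs : 0 < s) (ht : 0 < t)
    {u v : ℝ} (huv : u ≠ v) :
    (s * u + t * v) ^ 2 / (s * a + t * a) < s * (u ^ 2 / a) + t * (v ^ 2 / a) := by
  rw [← sub_pos, sq_div_combo_defect ha ha hs ht]
  have : u * a - v * a ≠ 0 := by
    rw [← sub_mul]; exact mul_ne_zero (sub_ne_zero.2 huv) ha.ne'
  positivity

end OneDimensional

section Gibbs

variable {N M K : ℕ} {F : Matrix (Fin M) (Fin N) ℝ} {R : Matrix (Fin K) (Fin N) ℝ}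
  {y : Fin M → ℝ} {r η rt ηt vtht : ℝ} {vth : Fin K → ℝ}

theorem ggibbs_eq (p : (Fin N → ℝ) × (Fin K → ℝ) × ℝ) :
    ggibbs N M K F R y r η rt ηt vtht vth p =
      (1 / 2) * ∑ j, (F.mulVec p.1 j - y j) ^ 2 / p.2.2
        + (1 / 2) * ∑ i, (R.mulVec p.1 i) ^ 2 / p.2.1 i
        + hyperPotential rt ηt vtht p.2.2
        + ∑ i, hyperPotential r η (vth i) (p.2.1 i) := by
  simp only [ggibbs, hyperPotential, Finset.sum_sub_distrib, ← Finset.mul_sum, ← Finset.sum_div]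
  ring

theorem isOpen_forall_pos : IsOpen {θ : Fin K → ℝ | ∀ i, 0 < θ i} := by
  simp only [ofPred_forall]
  exact isOpen_iInter_of_finite fun i => isOpen_lt continuous_const (continuous_apply i)

theorem differentiableAt_ggibbs (hr : 1 ≤ r) (hrt : 1 ≤ rt)
    {p : (Fin N → ℝ) × (Fin K → ℝ) × ℝ} (hθ : ∀ i, 0 < p.2.1 i) (hν : 0 < p.2.2) :
    DifferentiableAt ℝ (ggibbs N M K F R y r η rt ηt vtht vth) p := by
  have hF : ∀ j, DifferentiableAt ℝ
      (fun q : (Fin N → ℝ) × (Fin K → ℝ) × ℝ => F.mulVec q.1 j) p := fun j => by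
    simp only [Matrix.mulVec, dotProduct]; fun_prop
  have hR : ∀ i, DifferentiableAt ℝ
      (fun q : (Fin N → ℝ) × (Fin K → ℝ) × ℝ => R.mulVec q.1 i) p := fun i => by
    simp only [Matrix.mulVec, dotProduct]; fun_prop
  have hθ' : ∀ i, p.2.1 i ≠ 0 := fun i => (hθ i).ne'
  have hν' : p.2.2 ≠ 0 := hν.ne'
  have hcoord : ∀ i, DifferentiableAt ℝ
      (fun q : (Fin N → ℝ) × (Fin K → ℝ) × ℝ => q.2.1 i) p := fun i => by fun_prop
  have hpow : ∀ i, DifferentiableAt ℝ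
      (fun q : (Fin N → ℝ) × (Fin K → ℝ) × ℝ => (q.2.1 i / vth i) ^ r) p := fun i =>
    ((hcoord i).mul_const (vth i)⁻¹).rpow_const (Or.inr hr)
  have hpowt : DifferentiableAt ℝ
      (fun q : (Fin N → ℝ) × (Fin K → ℝ) × ℝ => (q.2.2 / vtht) ^ rt) p :=
    (differentiableAt_snd.snd.mul_const vtht⁻¹).rpow_const (Or.inr hrt)
  have hlog : ∀ i, DifferentiableAt ℝ
      (fun q : (Fin N → ℝ) × (Fin K → ℝ) × ℝ => Real.log (q.2.1 i)) p := fun i =>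
    (hcoord i).log (hθ' i)
  have hquot : ∀ i, DifferentiableAt ℝ
      (fun q : (Fin N → ℝ) × (Fin K → ℝ) × ℝ => (R.mulVec q.1 i) ^ 2 / q.2.1 i) p := fun i =>
    ((hR i).pow 2).mul ((hcoord i).inv (hθ' i))
  have hquot' : DifferentiableAt ℝ
      (fun q : (Fin N → ℝ) × (Fin K → ℝ) × ℝ => 1 / (2 * q.2.2)) p := by
    simp only [one_div]
    exact (differentiableAt_snd.snd.const_mul 2).inv (mul_ne_zero two_ne_zero hν')
  unfold ggibbs
  fun_prop (disch := assumption)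

theorem strictConvexOn_ggibbs
    (hker : LinearMap.ker F.mulVecLin ⊓ LinearMap.ker R.mulVecLin = ⊥)
    (hvth : ∀ i, 0 < vth i) (hvtht : 0 < vtht)
    (hr : 1 ≤ r) (hrt : 1 ≤ rt) (hη : 0 < η) (hηt : 0 < ηt) :
    StrictConvexOn ℝ ((univ : Set (Fin N → ℝ)) ×ˢ {θ : Fin K → ℝ | ∀ i, 0 < θ i} ×ˢ Ioi (0 : ℝ))
      (ggibbs N M K F R y r η rt ηt vtht vth) := by
  have hconvθ : Convex ℝ {θ : Fin K → ℝ | ∀ i, 0 < θ i} := by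
    intro θ hθ θ' hθ' s t hs ht hst i
    exact convex_Ioi (0 : ℝ) (hθ i) (hθ' i) hs ht hst
  refine ⟨convex_univ.prod (hconvθ.prod (convex_Ioi 0)), ?_⟩
  rintro ⟨x, θ, ν⟩ ⟨-, hθ, hν⟩ ⟨x', θ', ν'⟩ ⟨-, hθ', hν'⟩ hne s t hs ht hst
  simp only [mem_ofPred_eq, mem_Ioi] at hθ hν hθ' hν'
  have hFx : ∀ j, F.mulVec (s • x + t • x') j - y j
      = s * (F.mulVec x j - y j) + t * (F.mulVec x' j - y j) := fun j => by
    simp only [Matrix.mulVec_add, Matrix.mulVec_smul, Pi.add_apply, Pi.smul_apply, smul_eq_mul]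
    linear_combination y j * hst
  have hRx : ∀ i, R.mulVec (s • x + t • x') i = s * R.mulVec x i + t * R.mulVec x' i := fun i => by
    simp only [Matrix.mulVec_add, Matrix.mulVec_smul, Pi.add_apply, Pi.smul_apply, smul_eq_mul]
  have hF : ∀ j, (F.mulVec (s • x + t • x') j - y j) ^ 2 / (s * ν + t * ν')
      ≤ s * ((F.mulVec x j - y j) ^ 2 / ν) + t * ((F.mulVec x' j - y j) ^ 2 / ν') := fun j => by
    rw [hFx]; exact sq_div_combo_le hν hν' hs ht _ _
  have hR : ∀ i, R.mulVec (s • x + t • x') i ^ 2 / (s * θ i + t * θ' i)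
      ≤ s * (R.mulVec x i ^ 2 / θ i) + t * (R.mulVec x' i ^ 2 / θ' i) := fun i => by
    rw [hRx]; exact sq_div_combo_le (hθ i) (hθ' i) hs ht _ _
  have hVt := strictConvexOn_hyperPotential hrt hηt hvtht
  have hV := fun i => strictConvexOn_hyperPotential hr hη (hvth i)
  have hνc := hVt.convexOn.2 hν hν' hs.le ht.le hst
  have hθc := fun i => (hV i).convexOn.2 (hθ i) (hθ' i) hs.le ht.le hst
  have sF := Finset.sum_le_sum fun j (_ : j ∈ Finset.univ) => hF j
  have sR := Finset.sum_le_sum fun i (_ : i ∈ Finset.univ) => hR i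
  have sθ := Finset.sum_le_sum fun i (_ : i ∈ Finset.univ) => hθc i
  simp only [ggibbs_eq, Prod.smul_mk, Prod.mk_add_mk, Pi.add_apply, Pi.smul_apply, smul_eq_mul,
    Finset.sum_add_distrib, ← Finset.mul_sum] at *
  by_cases hνν : ν = ν'
  swap
  · have := hVt.2 hν hν' hνν hs ht hst
    simp only [smul_eq_mul] at this
    linarith
  by_cases hθθ : θ = θ'
  swap
  · obtain ⟨i₀, hi₀⟩ := Function.ne_iff.1 hθθ
    have h0 := (hV i₀).2 (hθ i₀) (hθ' i₀) hi₀ hs ht hst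
    have := Finset.sum_lt_sum (fun i (_ : i ∈ Finset.univ) => hθc i) ⟨i₀, Finset.mem_univ _, h0⟩
    simp only [Finset.sum_add_distrib, ← Finset.mul_sum] at this
    linarith
  subst hνν hθθ
  have hxx : x - x' ≠ 0 := fun h => hne (by rw [sub_eq_zero.1 h])
  have hcase : F.mulVec x ≠ F.mulVec x' ∨ R.mulVec x ≠ R.mulVec x' := by
    by_contra! h
    refine hxx ((Submodule.mem_bot ℝ).1 (hker ▸ ⟨?_, ?_⟩))
    · simp [Matrix.mulVec_sub, h.1]
    · simp [Matrix.mulVec_sub, h.2]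
  rcases hcase with h | h
  · obtain ⟨j₀, hj₀⟩ := Function.ne_iff.1 h
    have h0 := sq_div_combo_lt hν hs ht (sub_left_injective.ne hj₀ :
      F.mulVec x j₀ - y j₀ ≠ F.mulVec x' j₀ - y j₀)
    rw [← hFx] at h0
    have := Finset.sum_lt_sum (fun j (_ : j ∈ Finset.univ) => hF j) ⟨j₀, Finset.mem_univ _, h0⟩
    simp only [Finset.sum_add_distrib, ← Finset.mul_sum] at this
    linarith
  · obtain ⟨i₀, hi₀⟩ := Function.ne_iff.1 h
    have h0 := sq_div_combo_lt (hθ i₀) hs ht hi₀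
    rw [← hRx] at h0
    have := Finset.sum_lt_sum (fun i (_ : i ∈ Finset.univ) => hR i) ⟨i₀, Finset.mem_univ _, h0⟩
    simp only [Finset.sum_add_distrib, ← Finset.mul_sum] at this
    linarith

theorem isCompact_preimage_mulVec_prod
    (hker : LinearMap.ker F.mulVecLin ⊓ LinearMap.ker R.mulVecLin = ⊥)
    {S : Set ((Fin M → ℝ) × (Fin K → ℝ))} (hS : IsCompact S) :
    IsCompact {x : Fin N → ℝ | (F.mulVec x, R.mulVec x) ∈ S} :=
  ((F.mulVecLin.prod R.mulVecLin).isClosedEmbedding_of_injective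
    (by rw [LinearMap.ker_prod, hker])).isCompact_preimage hS

theorem isCompact_sublevel_ggibbs
    (hker : LinearMap.ker F.mulVecLin ⊓ LinearMap.ker R.mulVecLin = ⊥)
    (hvth : ∀ i, 0 < vth i) (hvtht : 0 < vtht)
    (hr : 1 ≤ r) (hrt : 1 ≤ rt) (hη : 0 < η) (hηt : 0 < ηt) (c : ℝ) :
    IsCompact {z ∈ (univ : Set (Fin N → ℝ)) ×ˢ {θ : Fin K → ℝ | ∀ i, 0 < θ i} ×ˢ Ioi (0 : ℝ) |
      ggibbs N M K F R y r η rt ηt vtht vth z ≤ c} := by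
  choose m hm using fun i => exists_le_hyperPotential hr hη (hvth i)
  obtain ⟨mt, hmt⟩ := exists_le_hyperPotential hrt hηt hvtht
  set d := c - mt - ∑ i, m i with hd
  choose a b ha hab using fun i => exists_Icc_of_hyperPotential_le hr hη (hvth i) (d + m i)
  obtain ⟨a₀, bt, hat, habt⟩ := exists_Icc_of_hyperPotential_le hrt hηt hvtht (d + mt)
  set Q : Set ((Fin N → ℝ) × (Fin K → ℝ) × ℝ) :=
    {x : Fin N → ℝ | (F.mulVec x, R.mulVec x) ∈
      Icc (fun j => y j - √(2 * d * bt)) (fun j => y j + √(2 * d * bt)) ×ˢ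
        Icc (fun i => -√(2 * d * b i)) (fun i => √(2 * d * b i))} ×ˢ Icc a b ×ˢ Icc a₀ bt
  have hQ : IsCompact Q :=
    (isCompact_preimage_mulVec_prod hker (isCompact_Icc.prod isCompact_Icc)).prod
      (isCompact_Icc.prod isCompact_Icc)
  have hQD : Q ⊆ (univ : Set (Fin N → ℝ)) ×ˢ {θ : Fin K → ℝ | ∀ i, 0 < θ i} ×ˢ Ioi (0 : ℝ) :=
    fun z hz => ⟨trivial, fun i => (ha i).trans_le (hz.2.1.1 i), hat.trans_le hz.2.2.1⟩
  have hcont : ContinuousOn (ggibbs N M K F R y r η rt ηt vtht vth) Q := fun z hz =>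
    (differentiableAt_ggibbs hr hrt (hQD hz).2.1 (hQD hz).2.2).continuousAt.continuousWithinAt
  convert hQ.of_isClosed_subset (hcont.preimage_isClosed_of_isClosed hQ.isClosed isClosed_Iic)
    (inter_subset_left) using 1
  ext ⟨x, θ, ν⟩
  refine ⟨?_, fun h => ⟨hQD h.1, h.2⟩⟩
  rintro ⟨⟨-, hθ, hν⟩, hle⟩
  refine ⟨?_, hle⟩
  simp only [mem_ofPred_eq, mem_Ioi] at hθ hν
  rw [ggibbs_eq] at hle
  dsimp only at hle
  have nF : ∀ j, 0 ≤ (F.mulVec x j - y j) ^ 2 / ν := fun j => by positivity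
  have nR : ∀ i, 0 ≤ R.mulVec x i ^ 2 / θ i := fun i => div_nonneg (sq_nonneg _) (hθ i).le
  have nV : ∀ i, 0 ≤ hyperPotential r η (vth i) (θ i) - m i := fun i => sub_nonneg.2 (hm i _ (hθ i))
  have nVt := hmt ν hν
  have sF := Finset.sum_nonneg fun j (_ : j ∈ Finset.univ) => nF j
  have sR := Finset.sum_nonneg fun i (_ : i ∈ Finset.univ) => nR i
  have sV := Finset.sum_nonneg fun i (_ : i ∈ Finset.univ) => nV i
  have hθI : ∀ i, θ i ∈ Icc (a i) (b i) := fun i => by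
    refine hab i _ (hθ i) ?_
    have := Finset.single_le_sum (fun i _ => nV i) (Finset.mem_univ i)
    simp only [Finset.sum_sub_distrib] at this
    linarith
  simp only [Finset.sum_sub_distrib] at sV
  have hνI : ν ∈ Icc a₀ bt := habt _ hν (by linarith)
  have hFI : ∀ j, |F.mulVec x j - y j| ≤ √(2 * d * bt) := fun j => by
    refine Real.abs_le_sqrt ?_
    have h1 := Finset.single_le_sum (fun j _ => nF j) (Finset.mem_univ j)
    have h2 : (F.mulVec x j - y j) ^ 2 / ν ≤ 2 * d := by linarith
    rw [div_le_iff₀ hν] at h2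
    exact h2.trans (mul_le_mul_of_nonneg_left hνI.2 (by linarith))
  have hRI : ∀ i, |R.mulVec x i| ≤ √(2 * d * b i) := fun i => by
    refine Real.abs_le_sqrt ?_
    have h1 := Finset.single_le_sum (fun i _ => nR i) (Finset.mem_univ i)
    have h2 : R.mulVec x i ^ 2 / θ i ≤ 2 * d := by linarith
    rw [div_le_iff₀ (hθ i)] at h2
    exact h2.trans (mul_le_mul_of_nonneg_left (hθI i).2 (by linarith))
  refine ⟨⟨⟨fun j => ?_, fun j => ?_⟩, fun i => (abs_le.1 (hRI i)).1, fun i => (abs_le.1 (hRI i)).2⟩,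
    ⟨fun i => (hθI i).1, fun i => (hθI i).2⟩, hνI⟩
  · have := (abs_le.1 (hFI j)).1
    dsimp only
    linarith
  · have := (abs_le.1 (hFI j)).2
    dsimp only
    linarith

end Gibbs

/-- Under the common kernel condition, if `r, r̃ ≥ 1`, `η > 0` and `η̃ > 0`, the
generalized Gibbs energy functional attains a unique global minimizer over
`ℝ^N × ℝ_{++}^K × ℝ_{++}`, and any sequence of exact block-coordinate (generalized IAS)
minimization iterates converges to it. -/
theorem statement10 (N M K : ℕ) (hN : 0 < N) (hM : 0 < M) (hK : 0 < K)
    (F : Matrix (Fin M) (Fin N) ℝ) (R : Matrix (Fin K) (Fin N) ℝ) (y : Fin M → ℝ)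
    (hker : LinearMap.ker F.mulVecLin ⊓ LinearMap.ker R.mulVecLin = ⊥)
    (r β η : ℝ) (hr0 : r ≠ 0) (hβ : 0 < β) (hη_def : η = r * β - 3 / 2)
    (vth : Fin K → ℝ) (hvth : ∀ i, 0 < vth i)
    (rt βt ηt vtht : ℝ) (hrt0 : rt ≠ 0) (hβt : 0 < βt)
    (hηt_def : ηt = rt * βt - (M + 2 : ℝ) / 2) (hvtht : 0 < vtht)
    (hr : 1 ≤ r) (hrt : 1 ≤ rt) (hη : 0 < η) (hηt : 0 < ηt) :
    ∃ p : (Fin N → ℝ) × (Fin K → ℝ) × ℝ,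
      (∀ i, 0 < p.2.1 i) ∧ 0 < p.2.2 ∧
      (∀ q : (Fin N → ℝ) × (Fin K → ℝ) × ℝ, (∀ i, 0 < q.2.1 i) → 0 < q.2.2 →
        ggibbs N M K F R y r η rt ηt vtht vth p ≤ ggibbs N M K F R y r η rt ηt vtht vth q) ∧
      (∀ q : (Fin N → ℝ) × (Fin K → ℝ) × ℝ, (∀ i, 0 < q.2.1 i) → 0 < q.2.2 → q ≠ p →
        ggibbs N M K F R y r η rt ηt vtht vth p < ggibbs N M K F R y r η rt ηt vtht vth q) ∧
      (∀ (x : ℕ → Fin N → ℝ) (θ : ℕ → Fin K → ℝ) (ν : ℕ → ℝ),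
        (∀ k i, 0 < θ k i) → (∀ k, 0 < ν k) →
        (∀ k, ∀ θ' : Fin K → ℝ, (∀ i, 0 < θ' i) →
          ggibbs N M K F R y r η rt ηt vtht vth (x k, θ (k + 1), ν k) ≤
            ggibbs N M K F R y r η rt ηt vtht vth (x k, θ', ν k)) →
        (∀ k, ∀ ν' : ℝ, 0 < ν' →
          ggibbs N M K F R y r η rt ηt vtht vth (x k, θ (k + 1), ν (k + 1)) ≤
            ggibbs N M K F R y r η rt ηt vtht vth (x k, θ (k + 1), ν')) →
        (∀ k, ∀ x' : Fin N → ℝ,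
          ggibbs N M K F R y r η rt ηt vtht vth (x (k + 1), θ (k + 1), ν (k + 1)) ≤
            ggibbs N M K F R y r η rt ηt vtht vth (x', θ (k + 1), ν (k + 1))) →
        Tendsto (fun k => (x k, θ k, ν k)) atTop (nhds p)) := by
  set G := ggibbs N M K F R y r η rt ηt vtht vth
  set D := (univ : Set (Fin N → ℝ)) ×ˢ {θ : Fin K → ℝ | ∀ i, 0 < θ i} ×ˢ Ioi (0 : ℝ)
  have hG : StrictConvexOn ℝ D G := strictConvexOn_ggibbs hker hvth hvtht hr hrt hη hηt
  have hdiff : ∀ z ∈ D, DifferentiableAt ℝ G z := fun z hz =>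
    differentiableAt_ggibbs hr hrt hz.2.1 hz.2.2
  have hcpt : ∀ c : ℝ, IsCompact {z ∈ D | G z ≤ c} :=
    isCompact_sublevel_ggibbs hker hvth hvtht hr hrt hη hηt
  have hz₀ : ((0, 1, 1) : (Fin N → ℝ) × (Fin K → ℝ) × ℝ) ∈ D :=
    ⟨trivial, fun _ => one_pos, mem_Ioi.2 one_pos⟩
  obtain ⟨p, ⟨hpD, hp₀⟩, hpmin⟩ := (hcpt (G (0, 1, 1))).exists_isMinOn ⟨_, hz₀, le_rfl⟩
    fun z hz => (hdiff z hz.1).continuousAt.continuousWithinAt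
  have hmin : ∀ q ∈ D, G p ≤ G q := fun q hq => by
    rcases le_total (G q) (G (0, 1, 1)) with h | h
    · exact hpmin ⟨hq, h⟩
    · exact hp₀.trans h
  refine ⟨p, hpD.2.1, hpD.2.2, fun q hθ hν => hmin q ⟨trivial, hθ, hν⟩, fun q hθ hν hne => ?_, ?_⟩
  · have hq : q ∈ D := ⟨trivial, hθ, hν⟩
    refine (hmin q hq).lt_of_ne fun heq => hne ?_
    exact hG.eq_of_le_midpoint hq hpD heq.symm
      (hmin _ (hG.1 hq hpD (by norm_num) (by norm_num) (by norm_num)))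
  · intro x θ ν hθ hν hstepθ hstepν hstepx
    exact hG.tendsto_of_block_descent isOpen_univ isOpen_forall_pos isOpen_Ioi hdiff hcpt hpD hmin
      (fun _ => trivial) hθ hν hstepθ hstepν fun k x' _ => hstepx k x'
end

section
/- Assume the common kernel condition ker(F) ∩ ker(R) = {0}, that either (r > 0 and η > 0) or (r < 0 and η < −3/2), and that either (r̃ > 0 and η̃ > 0) or (r̃ < 0 and η̃ < −(M+2)/2). Let (x^{(k)}, θ^{(k)}, ν^{(k)}) be a sequence in ℝ^N × ℝ_{++}^K × ℝ_{++} satisfying, for every k: θ^{(k+1)} minimizes θ ↦ G(x^{(k)}, θ, ν^{(k)}), ν^{(k+1)} minimizes ν ↦ G(x^{(k)}, θ^{(k+1)}, ν), and x^{(k+1)} minimizes x ↦ G(x, θ^{(k+1)}, ν^{(k+1)}). Then the sequence is bounded, and every limit point (x*, θ*, ν*) is a coordinate-wise minimizer of G: θ* minimizes θ ↦ G(x*, θ, ν*), ν* minimizes ν ↦ G(x*, θ*, ν), and x* minimizes x ↦ G(x, θ*, ν*). -/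
open Real Filter

/-- The scalar hyperprior term `(t / c) ^ r - η log t` dominates a multiple of `|log t|`. -/
lemma exists_abs_log_le_rpow_sub_log {r η c : ℝ} (hr : r ≠ 0) (hrη : 0 < η / r) (hc : 0 < c) :
    ∃ D : ℝ, ∀ t : ℝ, 0 < t → |η| * |log t| ≤ (t / c) ^ r - η * log t + D := by
  obtain ⟨κ, hκ⟩ : ∃ κ, κ = η / r := ⟨_, rfl⟩
  rw [← hκ] at hrη
  have hη : η = κ * r := by rw [hκ]; field_simp
  refine ⟨|2 * κ * (log (2 * κ) - 1)| + η * log c + |η| * |log c|, fun t ht => ?_⟩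
  obtain ⟨z, hz⟩ : ∃ z, z = r * log (t / c) := ⟨_, rfl⟩
  have hpow : (t / c) ^ r = exp z := by rw [rpow_def_of_pos (div_pos ht hc), hz, mul_comm]
  have hlog : log t = log (t / c) + log c := by rw [log_div ht.ne' hc.ne']; ring
  have hηz : η * log t = κ * z + η * log c := by rw [hlog, hz, hη]; ring
  have habs : |η| * |log t| ≤ κ * |z| + |η| * |log c| := by
    have h1 : |η| * |log (t / c)| = κ * |z| := by
      rw [hz, hη, abs_mul, abs_mul, abs_of_pos hrη]; ring
    rw [← h1, ← mul_add, hlog]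
    exact mul_le_mul_of_nonneg_left (abs_add_le _ _) (abs_nonneg _)
  have hexp : 2 * κ * (z - (log (2 * κ) - 1)) ≤ exp z := by
    have h2 : exp z = 2 * κ * exp (z - log (2 * κ)) := by
      rw [exp_sub, exp_log (by positivity)]; field_simp
    rw [h2]
    have := add_one_le_exp (z - log (2 * κ))
    exact mul_le_mul_of_nonneg_left (by linarith) (by positivity)
  have hmain : κ * |z| ≤ exp z - κ * z + |2 * κ * (log (2 * κ) - 1)| := by
    have h3 := le_abs_self (2 * κ * (log (2 * κ) - 1))
    have h4 := abs_nonneg (2 * κ * (log (2 * κ) - 1))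
    rcases abs_cases z with ⟨h, _⟩ | ⟨h, _⟩
    · rw [h]; linarith
    · rw [h]; linarith [exp_pos z]
  rw [hpow, hηz]
  linarith

/-- The energy dominates its quadratic part plus a multiple of the logarithms of the scales. -/
lemma exists_le_ggibbs_add {N M K : ℕ} (F : Matrix (Fin M) (Fin N) ℝ)
    (R : Matrix (Fin K) (Fin N) ℝ) (y : Fin M → ℝ) {r η rt ηt vtht : ℝ} {vth : Fin K → ℝ}
    (hr : r ≠ 0) (hrη : 0 < η / r) (hvth : ∀ i, 0 < vth i)
    (hrt : rt ≠ 0) (hrηt : 0 < ηt / rt) (hvtht : 0 < vtht) :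
    ∃ D : ℝ, ∀ (x : Fin N → ℝ) (θ : Fin K → ℝ) (ν : ℝ), (∀ i, 0 < θ i) → 0 < ν →
      (1 / (2 * ν)) * ∑ j, (F.mulVec x j - y j) ^ 2
        + (1 / 2) * ∑ i, (R.mulVec x i) ^ 2 / θ i
        + |ηt| * |log ν| + ∑ i, |η| * |log (θ i)|
        ≤ ggibbs N M K F R y r η rt ηt vtht vth (x, θ, ν) + D := by
  obtain ⟨Dt, hDt⟩ := exists_abs_log_le_rpow_sub_log hrt hrηt hvtht
  choose D hD using fun i => exists_abs_log_le_rpow_sub_log hr hrη (hvth i)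
  refine ⟨Dt + ∑ i, D i, fun x θ ν hθ hν => ?_⟩
  have h1 := hDt ν hν
  have h2 : ∑ i, |η| * |log (θ i)| ≤ ∑ i, ((θ i / vth i) ^ r - η * log (θ i) + D i) :=
    Finset.sum_le_sum fun i _ => hD i (θ i) (hθ i)
  rw [Finset.sum_add_distrib, Finset.sum_sub_distrib] at h2
  simp only [ggibbs, Finset.mul_sum (Finset.univ : Finset (Fin K)) (fun i => log (θ i)) η]
  linarith

lemma continuousAt_ggibbs {N M K : ℕ} (F : Matrix (Fin M) (Fin N) ℝ)
    (R : Matrix (Fin K) (Fin N) ℝ) (y : Fin M → ℝ) (r η rt ηt : ℝ) {vtht : ℝ} {vth : Fin K → ℝ}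
    (hvth : ∀ i, 0 < vth i) (hvtht : 0 < vtht) {p : (Fin N → ℝ) × (Fin K → ℝ) × ℝ}
    (hθ : ∀ i, 0 < p.2.1 i) (hν : 0 < p.2.2) :
    ContinuousAt (ggibbs N M K F R y r η rt ηt vtht vth) p := by
  have hνc : ContinuousAt (fun q : (Fin N → ℝ) × (Fin K → ℝ) × ℝ => q.2.2) p := by fun_prop
  have hθc : ∀ i, ContinuousAt (fun q : (Fin N → ℝ) × (Fin K → ℝ) × ℝ => q.2.1 i) p :=
    fun i => by fun_prop
  have hF : Continuous (fun q : (Fin N → ℝ) × (Fin K → ℝ) × ℝ =>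
      ∑ j, (F.mulVec q.1 j - y j) ^ 2) := by
    simp only [Matrix.mulVec, dotProduct]; fun_prop
  have hR : ∀ i, Continuous (fun q : (Fin N → ℝ) × (Fin K → ℝ) × ℝ => (R.mulVec q.1 i) ^ 2) := by
    intro i
    simp only [Matrix.mulVec, dotProduct]; fun_prop
  unfold ggibbs
  refine ((((ContinuousAt.add (ContinuousAt.add (ContinuousAt.mul ?_ hF.continuousAt)
    (continuousAt_const.mul ?_)) ?_).add ?_).sub (continuousAt_const.mul (hνc.log hν.ne'))).sub
    (continuousAt_const.mul ?_))
  · exact continuousAt_const.div (continuousAt_const.mul hνc) (by positivity)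
  · exact tendsto_finsetSum _ fun i _ => (hR i).continuousAt.div (hθc i) (hθ i).ne'
  · exact (hνc.div_const _).rpow_const (Or.inl (div_pos hν hvtht).ne')
  · exact tendsto_finsetSum _ fun i _ =>
      ((hθc i).div_const _).rpow_const (Or.inl (div_pos (hθ i) (hvth i)).ne')
  · exact tendsto_finsetSum _ fun i _ => (hθc i).log (hθ i).ne'

/-- Under the common kernel condition a vector is bounded in terms of its two images. -/
lemma exists_norm_le_of_ker_inf_ker_eq_bot {N M K : ℕ} {F : Matrix (Fin M) (Fin N) ℝ}
    {R : Matrix (Fin K) (Fin N) ℝ}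
    (hker : LinearMap.ker F.mulVecLin ⊓ LinearMap.ker R.mulVecLin = ⊥) (A : ℝ) :
    ∃ C : ℝ, ∀ x : Fin N → ℝ, ‖F.mulVec x‖ ≤ A → ‖R.mulVec x‖ ≤ A → ‖x‖ ≤ C := by
  obtain ⟨L, -, hL⟩ := LinearMap.exists_antilipschitzWith (F.mulVecLin.prod R.mulVecLin)
    (by rw [LinearMap.ker_prod, hker])
  refine ⟨L * A, fun x hF hR => ?_⟩
  have h := hL.le_mul_dist x 0
  rw [map_zero, dist_zero_right, dist_zero_right] at h
  exact h.trans (mul_le_mul_of_nonneg_left (max_le hF hR) L.2)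

/-- A sublevel set of the energy is bounded, and the scales stay away from zero on it. -/
lemma exists_bounds_of_ggibbs_le {N M K : ℕ} {F : Matrix (Fin M) (Fin N) ℝ}
    {R : Matrix (Fin K) (Fin N) ℝ} (y : Fin M → ℝ) {r η rt ηt vtht : ℝ} {vth : Fin K → ℝ}
    (hker : LinearMap.ker F.mulVecLin ⊓ LinearMap.ker R.mulVecLin = ⊥)
    (hr : r ≠ 0) (hrη : 0 < η / r) (hvth : ∀ i, 0 < vth i)
    (hrt : rt ≠ 0) (hrηt : 0 < ηt / rt) (hvtht : 0 < vtht) (E : ℝ) :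
    ∃ a b C : ℝ, 0 < a ∧ ∀ (x : Fin N → ℝ) (θ : Fin K → ℝ) (ν : ℝ), (∀ i, 0 < θ i) → 0 < ν →
      ggibbs N M K F R y r η rt ηt vtht vth (x, θ, ν) ≤ E →
      ‖x‖ ≤ C ∧ (∀ i, θ i ∈ Set.Icc a b) ∧ ν ∈ Set.Icc a b := by
  obtain ⟨D, hD⟩ := exists_le_ggibbs_add F R y hr hrη hvth hrt hrηt hvtht
  have hη : 0 < |η| := abs_pos.2 fun h => by simp [h] at hrη
  have hηt : 0 < |ηt| := abs_pos.2 fun h => by simp [h] at hrηt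
  obtain ⟨B, hB⟩ : ∃ B, B = max ((E + D) / |η|) ((E + D) / |ηt|) := ⟨_, rfl⟩
  obtain ⟨A, hA⟩ : ∃ A, A = √(2 * exp B * (E + D)) := ⟨_, rfl⟩
  obtain ⟨C, hC⟩ := exists_norm_le_of_ker_inf_ker_eq_bot hker (A + ‖y‖)
  refine ⟨exp (-B), exp B, C, exp_pos _, fun x θ ν hθ hν hE => ?_⟩
  have hlow := hD x θ ν hθ hν
  have hF0 : 0 ≤ (1 / (2 * ν)) * ∑ j, (F.mulVec x j - y j) ^ 2 := by positivity
  have hRi0 : ∀ i, 0 ≤ (R.mulVec x i) ^ 2 / θ i := fun i => div_nonneg (sq_nonneg _) (hθ i).le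
  have hR0 : 0 ≤ ∑ i, (R.mulVec x i) ^ 2 / θ i := Finset.sum_nonneg fun i _ => hRi0 i
  have hν0 : 0 ≤ |ηt| * |log ν| := by positivity
  have hθ0 : 0 ≤ ∑ i, |η| * |log (θ i)| := by positivity
  have hmem : ∀ t : ℝ, 0 < t → |log t| ≤ B → t ∈ Set.Icc (exp (-B)) (exp B) := by
    intro t ht h
    rw [abs_le] at h
    exact ⟨(le_log_iff_exp_le ht).1 h.1, (log_le_iff_le_exp ht).1 h.2⟩
  have hνmem : ν ∈ Set.Icc (exp (-B)) (exp B) := by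
    refine hmem ν hν (le_trans ?_ (hB ▸ le_max_right _ _))
    rw [le_div_iff₀ hηt]
    linarith
  have hθmem : ∀ i, θ i ∈ Set.Icc (exp (-B)) (exp B) := by
    intro i
    refine hmem _ (hθ i) (le_trans ?_ (hB ▸ le_max_left _ _))
    rw [le_div_iff₀ hη]
    have : |η| * |log (θ i)| ≤ ∑ i, |η| * |log (θ i)| :=
      Finset.single_le_sum (f := fun i => |η| * |log (θ i)|) (fun i _ => by positivity)
        (Finset.mem_univ i)
    linarith
  refine ⟨hC x ?_ ?_, hθmem, hνmem⟩
  · have hFy : ‖F.mulVec x - y‖ ≤ A := by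
      rw [pi_norm_le_iff_of_nonneg (hA ▸ sqrt_nonneg _)]
      intro j
      rw [hA]
      refine abs_le_sqrt ?_
      have h1 : (F.mulVec x j - y j) ^ 2 ≤ ∑ j, (F.mulVec x j - y j) ^ 2 :=
        Finset.single_le_sum (f := fun j => (F.mulVec x j - y j) ^ 2) (fun j _ => sq_nonneg _)
          (Finset.mem_univ j)
      have h2 : ∑ j, (F.mulVec x j - y j) ^ 2
          = 2 * ν * ((1 / (2 * ν)) * ∑ j, (F.mulVec x j - y j) ^ 2) := by field_simp
      refine h1.trans (h2.le.trans (mul_le_mul ?_ ?_ hF0 (by positivity)))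
      · linarith [hνmem.2]
      · linarith
    calc ‖F.mulVec x‖ = ‖(F.mulVec x - y) + y‖ := by rw [sub_add_cancel]
      _ ≤ A + ‖y‖ := (norm_add_le _ _).trans (by linarith)
  · refine le_trans ?_ (le_add_of_nonneg_right (norm_nonneg y))
    rw [pi_norm_le_iff_of_nonneg (hA ▸ sqrt_nonneg _)]
    intro i
    rw [hA]
    refine abs_le_sqrt ?_
    have h1 : (R.mulVec x i) ^ 2 / θ i ≤ ∑ i, (R.mulVec x i) ^ 2 / θ i :=
      Finset.single_le_sum (f := fun i => (R.mulVec x i) ^ 2 / θ i) (fun i _ => hRi0 i)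
        (Finset.mem_univ i)
    have h2 : (R.mulVec x i) ^ 2 = 2 * θ i * (1 / 2 * ((R.mulVec x i) ^ 2 / θ i)) := by
      have := (hθ i).ne'
      field_simp
    rw [h2]
    refine mul_le_mul ?_ ?_ (mul_nonneg (by norm_num) (hRi0 i)) (by positivity)
    · linarith [(hθmem i).2]
    · linarith

/-- The value at a limit point is a lower bound of the values along a sequence on which `g`
decreases. -/
lemma le_of_antitone_of_tendsto_subseq {X : Type*} [TopologicalSpace X] {g : X → ℝ} {u : ℕ → X}
    {p : X} {ψ : ℕ → ℕ} (hg : Antitone fun k => g (u k)) (hψ : StrictMono ψ)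
    (hu : Tendsto (u ∘ ψ) atTop (nhds p)) (hc : ContinuousAt g p) (k : ℕ) : g p ≤ g (u k) := by
  refine le_of_tendsto (hc.tendsto.comp hu) ?_
  filter_upwards [hψ.tendsto_atTop.eventually_ge_atTop k] with j hj using hg hj

/-- Under the common kernel condition and the stated hyper-parameter conditions, any
sequence of exact block-coordinate (generalized IAS) minimization iterates is bounded,
and every limit point is a coordinate-wise minimizer of `G`. -/
theorem statement11 (N M K : ℕ) (hN : 0 < N) (hM : 0 < M) (hK : 0 < K)
    (F : Matrix (Fin M) (Fin N) ℝ) (R : Matrix (Fin K) (Fin N) ℝ) (y : Fin M → ℝ)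
    (hker : LinearMap.ker F.mulVecLin ⊓ LinearMap.ker R.mulVecLin = ⊥)
    (r β η : ℝ) (hr0 : r ≠ 0) (hβ : 0 < β) (hη_def : η = r * β - 3 / 2)
    (vth : Fin K → ℝ) (hvth : ∀ i, 0 < vth i)
    (rt βt ηt vtht : ℝ) (hrt0 : rt ≠ 0) (hβt : 0 < βt)
    (hηt_def : ηt = rt * βt - (M + 2 : ℝ) / 2) (hvtht : 0 < vtht)
    (hcase_r : (0 < r ∧ 0 < η) ∨ (r < 0 ∧ η < -(3 / 2)))
    (hcase_rt : (0 < rt ∧ 0 < ηt) ∨ (rt < 0 ∧ ηt < -((M + 2 : ℝ) / 2)))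
    (x : ℕ → Fin N → ℝ) (θ : ℕ → Fin K → ℝ) (ν : ℕ → ℝ)
    (hθpos : ∀ k i, 0 < θ k i) (hνpos : ∀ k, 0 < ν k)
    (hθmin : ∀ k, ∀ θ' : Fin K → ℝ, (∀ i, 0 < θ' i) →
      ggibbs N M K F R y r η rt ηt vtht vth (x k, θ (k + 1), ν k) ≤
        ggibbs N M K F R y r η rt ηt vtht vth (x k, θ', ν k))
    (hνmin : ∀ k, ∀ ν' : ℝ, 0 < ν' →
      ggibbs N M K F R y r η rt ηt vtht vth (x k, θ (k + 1), ν (k + 1)) ≤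
        ggibbs N M K F R y r η rt ηt vtht vth (x k, θ (k + 1), ν'))
    (hxmin : ∀ k, ∀ x' : Fin N → ℝ,
      ggibbs N M K F R y r η rt ηt vtht vth (x (k + 1), θ (k + 1), ν (k + 1)) ≤
        ggibbs N M K F R y r η rt ηt vtht vth (x', θ (k + 1), ν (k + 1))) :
    Bornology.IsBounded (Set.range fun k => (x k, θ k, ν k)) ∧
    ∀ p : (Fin N → ℝ) × (Fin K → ℝ) × ℝ,
      MapClusterPt p atTop (fun k => (x k, θ k, ν k)) →
      (∀ i, 0 < p.2.1 i) ∧ 0 < p.2.2 ∧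
      (∀ θ' : Fin K → ℝ, (∀ i, 0 < θ' i) →
        ggibbs N M K F R y r η rt ηt vtht vth p ≤
          ggibbs N M K F R y r η rt ηt vtht vth (p.1, θ', p.2.2)) ∧
      (∀ ν' : ℝ, 0 < ν' →
        ggibbs N M K F R y r η rt ηt vtht vth p ≤
          ggibbs N M K F R y r η rt ηt vtht vth (p.1, p.2.1, ν')) ∧
      (∀ x' : Fin N → ℝ,
        ggibbs N M K F R y r η rt ηt vtht vth p ≤
          ggibbs N M K F R y r η rt ηt vtht vth (x', p.2.1, p.2.2)) := by
  have hrη : 0 < η / r := by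
    rcases hcase_r with ⟨h1, h2⟩ | ⟨h1, h2⟩
    · exact div_pos h2 h1
    · exact div_pos_of_neg_of_neg (by linarith) h1
  have hrηt : 0 < ηt / rt := by
    rcases hcase_rt with ⟨h1, h2⟩ | ⟨h1, h2⟩
    · exact div_pos h2 h1
    · exact div_pos_of_neg_of_neg (h2.trans (neg_neg_of_pos (by positivity))) h1
  set G := ggibbs N M K F R y r η rt ηt vtht vth with hG
  have hνθ : ∀ k, G (x k, θ (k + 1), ν (k + 1)) ≤ G (x k, θ (k + 1), ν k) :=
    fun k => hνmin k _ (hνpos k)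
  have hanti : Antitone fun k => G (x k, θ k, ν k) := antitone_nat_of_succ_le fun k =>
    (hxmin k (x k)).trans ((hνθ k).trans (hθmin k _ (hθpos k)))
  obtain ⟨a, b, C, ha, hbd⟩ := exists_bounds_of_ggibbs_le y hker hr0 hrη hvth hrt0 hrηt hvtht
    (G (x 0, θ 0, ν 0))
  have hbound := fun k => hbd (x k) (θ k) (ν k) (hθpos k) (hνpos k) (hanti (Nat.zero_le k))
  refine ⟨?_, fun p hp => ?_⟩
  · refine (Metric.isBounded_closedBall (x := (0 : Fin N → ℝ)) (r := C)).prod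
      ((Metric.isBounded_Icc (fun _ : Fin K => a) (fun _ => b)).prod (Metric.isBounded_Icc a b))
      |>.subset ?_
    rintro _ ⟨k, rfl⟩
    obtain ⟨hx, hθ, hν⟩ := hbound k
    exact ⟨by simpa using hx, ⟨fun i => (hθ i).1, fun i => (hθ i).2⟩, hν⟩
  obtain ⟨ψ, hψ, hu⟩ := hp.tendsto_subseq
  have hxlim : Tendsto (fun j => x (ψ j)) atTop (nhds p.1) := hu.fst_nhds
  have hθlim : Tendsto (fun j => θ (ψ j)) atTop (nhds p.2.1) := hu.snd_nhds.fst_nhds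
  have hνlim : Tendsto (fun j => ν (ψ j)) atTop (nhds p.2.2) := hu.snd_nhds.snd_nhds
  have hθp : ∀ i, 0 < p.2.1 i := fun i => ha.trans_le <|
    ge_of_tendsto' (tendsto_pi_nhds.1 hθlim i) fun j => ((hbound (ψ j)).2.1 i).1
  have hνp : 0 < p.2.2 := ha.trans_le <| ge_of_tendsto' hνlim fun j => (hbound (ψ j)).2.2.1
  have hcont : ∀ q : (Fin N → ℝ) × (Fin K → ℝ) × ℝ, (∀ i, 0 < q.2.1 i) → 0 < q.2.2 →
      ContinuousAt G q := fun q h1 h2 => continuousAt_ggibbs F R y r η rt ηt hvth hvtht h1 h2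
  have hlow : ∀ k, G p ≤ G (x k, θ k, ν k) :=
    le_of_antitone_of_tendsto_subseq hanti hψ hu (hcont p hθp hνp)
  refine ⟨hθp, hνp, fun θ' hθ' => ?_, fun ν' hν' => ?_, fun x' => ?_⟩
  · refine ge_of_tendsto' ((hcont (p.1, θ', p.2.2) hθ' hνp).tendsto.comp
      (hxlim.prodMk_nhds (tendsto_const_nhds.prodMk_nhds hνlim))) fun j => ?_
    exact (hlow (ψ j + 1)).trans ((hxmin _ _).trans ((hνθ _).trans (hθmin _ _ hθ')))
  · refine ge_of_tendsto' ((hcont (p.1, p.2.1, ν') hθp hν').tendsto.comp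
      (hxlim.prodMk_nhds (hθlim.prodMk_nhds tendsto_const_nhds))) fun j => ?_
    have h1 := (hlow (ψ j + 1)).trans ((hxmin _ _).trans (hνmin (ψ j) ν' hν'))
    have h2 := hθmin (ψ j) _ (hθpos (ψ j))
    -- the energy is a sum of a function of `(x, θ)` and a function of `(x, ν)`
    refine h1.trans ?_
    simp only [hG, ggibbs, Function.comp_apply] at h2 ⊢
    linarith
  · refine ge_of_tendsto ((hcont (x', p.2.1, p.2.2) hθp hνp).tendsto.comp
      (tendsto_const_nhds.prodMk_nhds (hθlim.prodMk_nhds hνlim))) ?_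
    filter_upwards [hψ.tendsto_atTop.eventually_ge_atTop 1] with j hj
    obtain ⟨k, hk⟩ := Nat.exists_eq_add_of_le' hj
    have := (hlow (k + 1)).trans (hxmin k x')
    rwa [← hk] at this
end

section
/- Suppose either (0 < r < 1 and η > 0) or (r < 0), where η = rβ − 3/2. Then the function G₁(x, θ) = (1/2)∑_{i=1}^K ([Rx]_i)²/θ_i + ∑_{i=1}^K (θ_i/ϑ_i)^r − η ∑_{i=1}^K log θ_i is convex on the convex open region of all (x, θ) ∈ ℝ^N × ℝ_{++}^K with θ_i < ϑ_i (η/(r·|r − 1|))^{1/r} for every i = 1, …, K. -/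
open Real

/-- `G₁(x, θ) = (1/2)∑ᵢ ([Rx]ᵢ)²/θᵢ + ∑ᵢ (θᵢ/ϑᵢ)^r − η ∑ᵢ log θᵢ`. -/
noncomputable def gibbsG1 (N K : ℕ) (R : Matrix (Fin K) (Fin N) ℝ)
    (r η : ℝ) (vth : Fin K → ℝ) : (Fin N → ℝ) × (Fin K → ℝ) → ℝ :=
  fun p =>
    (1 / 2) * ∑ i, (R.mulVec p.1 i) ^ 2 / p.2 i
      + ∑ i, (p.2 i / vth i) ^ r
      - η * ∑ i, Real.log (p.2 i)

/-- The quadratic-over-linear function `(y, t) ↦ y² / t` is jointly convex for `t > 0`. -/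
theorem sq_div_convex_comb_le {y₁ y₂ t₁ t₂ a b : ℝ} (ht₁ : 0 < t₁) (ht₂ : 0 < t₂)
    (ha : 0 ≤ a) (hb : 0 ≤ b) (hT : 0 < a * t₁ + b * t₂) :
    (a * y₁ + b * y₂) ^ 2 / (a * t₁ + b * t₂) ≤ a * (y₁ ^ 2 / t₁) + b * (y₂ ^ 2 / t₂) := by
  have tangent : ∀ s y t : ℝ, 0 < t → 2 * s * y - s ^ 2 * t ≤ y ^ 2 / t := by
    intro s y t ht
    rw [le_div_iff₀ ht]
    nlinarith [sq_nonneg (y - s * t)]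
  set s := (a * y₁ + b * y₂) / (a * t₁ + b * t₂)
  have key : (a * y₁ + b * y₂) ^ 2 / (a * t₁ + b * t₂)
      = a * (2 * s * y₁ - s ^ 2 * t₁) + b * (2 * s * y₂ - s ^ 2 * t₂) := by
    have hsT : s * (a * t₁ + b * t₂) = a * y₁ + b * y₂ := div_mul_cancel₀ _ hT.ne'
    rw [← hsT, div_eq_iff hT.ne']
    linear_combination (2 * s * (a * t₁ + b * t₂)) * hsT
  rw [key]
  exact add_le_add (mul_le_mul_of_nonneg_left (tangent s y₁ t₁ ht₁) ha)
    (mul_le_mul_of_nonneg_left (tangent s y₂ t₂ ht₂) hb)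

/-- `t ↦ (t / v)^r - η log t` is convex on an interval of positive reals on which
`r (r - 1) (t / v)^r + η ≥ 0`. -/
theorem convexOn_div_rpow_sub_log {r η v u : ℝ} (hv : 0 < v)
    (h : ∀ t ∈ Set.Ioo 0 u, 0 ≤ r * (r - 1) * (t / v) ^ r + η) :
    ConvexOn ℝ (Set.Ioo 0 u) (fun t => (t / v) ^ r - η * Real.log t) := by
  have h₁ : ∀ t ∈ Set.Ioo 0 u, HasDerivAt (fun t => (t / v) ^ r - η * Real.log t)
      (1 / v * r * (t / v) ^ (r - 1) - η * t⁻¹) t := fun t ht =>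
    (((hasDerivAt_id t).div_const v).rpow_const (Or.inl (div_pos ht.1 hv).ne')).sub
      ((Real.hasDerivAt_log ht.1.ne').const_mul η)
  have h₂ : ∀ t ∈ Set.Ioo 0 u, HasDerivAt
      (fun t => 1 / v * r * (t / v) ^ (r - 1) - η * t⁻¹)
      (1 / v * r * (1 / v * (r - 1) * (t / v) ^ (r - 1 - 1)) - η * -(t ^ 2)⁻¹) t := fun t ht =>
    ((((hasDerivAt_id t).div_const v).rpow_const
      (Or.inl (div_pos ht.1 hv).ne')).const_mul (1 / v * r)).sub
      ((hasDerivAt_inv ht.1.ne').const_mul η)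
  refine convexOn_of_hasDerivWithinAt2_nonneg (convex_Ioo 0 u)
    (fun t ht => (h₁ t ht).continuousAt.continuousWithinAt)
    (fun t ht => (h₁ t (interior_subset ht)).hasDerivWithinAt)
    (fun t ht => (h₂ t (interior_subset ht)).hasDerivWithinAt) fun t ht => ?_
  have ht := interior_subset ht
  have ht0 : 0 < t := ht.1
  have hpos : 0 < t / v := div_pos ht0 hv
  have heq : 1 / v * r * (1 / v * (r - 1) * (t / v) ^ (r - 1 - 1)) - η * -(t ^ 2)⁻¹
      = (r * (r - 1) * (t / v) ^ r + η) / t ^ 2 := by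
    rw [Real.rpow_sub_one hpos.ne', Real.rpow_sub_one hpos.ne']
    generalize (t / v) ^ r = w
    field_simp
    ring
  rw [heq]
  exact div_nonneg (h t ht) (sq_nonneg t)

/-- Below the threshold `v (η / (r |r - 1|))^(1/r)`, the numerator `r (r - 1) (t / v)^r + η` of
the second derivative of `t ↦ (t / v)^r - η log t` is nonnegative. -/
theorem rpow_add_nonneg_of_lt_threshold {r η v t : ℝ} (hv : 0 < v)
    (hcase : (0 < r ∧ r < 1 ∧ 0 < η) ∨ (r < 0 ∧ η < 0)) (ht : 0 < t)
    (htu : t < v * (η / (r * |r - 1|)) ^ (1 / r)) :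
    0 ≤ r * (r - 1) * (t / v) ^ r + η := by
  have hr1 : r < 1 := by rcases hcase with h | h <;> linarith
  have hr0 : r ≠ 0 := by rcases hcase with h | h <;> [exact h.1.ne'; exact h.1.ne]
  have habs : |r - 1| = 1 - r := by rw [abs_of_neg (by linarith)]; ring
  rw [habs] at htu
  have h1r : 0 < 1 - r := by linarith
  set c := η / (r * (1 - r)) with hc
  have hcη : η = r * (1 - r) * c := by rw [hc]; field_simp
  have hcpos : 0 < c := by
    rcases hcase with ⟨h, -, hη⟩ | ⟨h, hη⟩
    · exact div_pos hη (mul_pos h h1r)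
    · exact div_pos_of_neg_of_neg hη (mul_neg_of_neg_of_pos h h1r)
  have hlt : t / v ≤ c ^ (1 / r) := by
    rw [div_le_iff₀ hv, mul_comm]; exact htu.le
  have hcr : (c ^ (1 / r)) ^ r = c := by
    rw [← Real.rpow_mul hcpos.le, one_div_mul_cancel hr0, Real.rpow_one]
  have htv : 0 < t / v := div_pos ht hv
  have hprod : 0 ≤ r * (c - (t / v) ^ r) := by
    rcases hcase with ⟨h, -⟩ | ⟨h, -⟩
    · have := Real.rpow_le_rpow htv.le hlt h.le
      rw [hcr] at this
      exact mul_nonneg h.le (by linarith)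
    · have := Real.rpow_le_rpow_of_nonpos htv hlt h.le
      rw [hcr] at this
      exact mul_nonneg_of_nonpos_of_nonpos h.le (by linarith)
  calc 0 ≤ (1 - r) * (r * (c - (t / v) ^ r)) := mul_nonneg h1r.le hprod
    _ = r * (r - 1) * (t / v) ^ r + η := by rw [hcη]; ring

/-- If `(0 < r < 1 ∧ η > 0)` or `r < 0`, then `G₁` is convex on the region of all
`(x, θ) ∈ ℝ^N × ℝ_{++}^K` with `θᵢ < ϑᵢ (η/(r|r−1|))^{1/r}` for all `i`. -/
theorem statement15 (N K : ℕ) (hN : 0 < N) (hK : 0 < K)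
    (R : Matrix (Fin K) (Fin N) ℝ)
    (r β η : ℝ) (hr0 : r ≠ 0) (hβ : 0 < β) (hη_def : η = r * β - 3 / 2)
    (vth : Fin K → ℝ) (hvth : ∀ i, 0 < vth i)
    (hcase : (0 < r ∧ r < 1 ∧ 0 < η) ∨ r < 0) :
    ConvexOn ℝ
      {p : (Fin N → ℝ) × (Fin K → ℝ) |
        ∀ i, 0 < p.2 i ∧ p.2 i < vth i * (η / (r * |r - 1|)) ^ (1 / r)}
      (gibbsG1 N K R r η vth) := by
  have hcase' : (0 < r ∧ r < 1 ∧ 0 < η) ∨ (r < 0 ∧ η < 0) :=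
    hcase.imp_right fun h => ⟨h, by linarith [mul_neg_of_neg_of_pos h hβ]⟩
  set u : Fin K → ℝ := fun i => vth i * (η / (r * |r - 1|)) ^ (1 / r)
  have hconv : ∀ i, ConvexOn ℝ (Set.Ioo 0 (u i))
      (fun t => (t / vth i) ^ r - η * Real.log t) := fun i =>
    convexOn_div_rpow_sub_log (hvth i) fun t ht =>
      rpow_add_nonneg_of_lt_threshold (hvth i) hcase' ht.1 ht.2
  have hG : ∀ p, gibbsG1 N K R r η vth p = ∑ i, (1 / 2 * ((R.mulVec p.1 i) ^ 2 / p.2 i)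
      + ((p.2 i / vth i) ^ r - η * Real.log (p.2 i))) := fun p => by
    simp only [gibbsG1, Finset.sum_add_distrib, Finset.sum_sub_distrib, Finset.mul_sum]
    ring
  have hmem : ∀ p q : (Fin N → ℝ) × (Fin K → ℝ), (∀ i, p.2 i ∈ Set.Ioo 0 (u i)) →
      (∀ i, q.2 i ∈ Set.Ioo 0 (u i)) → ∀ a b : ℝ, 0 ≤ a → 0 ≤ b → a + b = 1 →
      ∀ i, a * p.2 i + b * q.2 i ∈ Set.Ioo 0 (u i) := fun p q hp hq a b ha hb hab i =>
    convex_Ioo 0 (u i) (hp i) (hq i) ha hb hab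
  refine ⟨fun p hp q hq a b ha hb hab => hmem p q hp hq a b ha hb hab,
    fun p hp q hq a b ha hb hab => ?_⟩
  rw [hG, hG, hG, smul_eq_mul, smul_eq_mul, Finset.mul_sum, Finset.mul_sum,
    ← Finset.sum_add_distrib]
  refine Finset.sum_le_sum fun i _ => ?_
  have hquad := sq_div_convex_comb_le (y₁ := R.mulVec p.1 i) (y₂ := R.mulVec q.1 i)
    (hp i).1 (hq i).1 ha hb (hmem p q hp hq a b ha hb hab i).1
  have hscalar := (hconv i).2 (hp i) (hq i) ha hb hab
  simp only [smul_eq_mul] at hscalar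
  simp only [Prod.fst_add, Prod.snd_add, Prod.smul_fst, Prod.smul_snd, Matrix.mulVec_add,
    Matrix.mulVec_smul, Pi.add_apply, Pi.smul_apply, smul_eq_mul]
  linarith
end
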